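/- arXiv:2405.19810 — 7 statements merged into one kernel-verified Lean document; each statement's English description precedes it below -/
import Mathlib

section
/- Every numerical monoid Γ with embedding dimension 5 and multiplicity 11 satisfies type(Γ) ≤ 6, and the numerical monoid generated by {11, 12, 14, 15, 20} has embedding dimension 5, multiplicity 11, and type exactly 6. (Since 𝒟(4,11) = 7, this says 𝒯(4,11) = 𝒟(4,11) − 1.) -/
open scoped Pointwise

/-- A numerical monoid: an additive submonoid of ℕ with finite complement. -/
def IsNumericalMonoid (Γ : AddSubmonoid ℕ) : Prop :=
  ((Γ : Set ℕ)ᶜ).Finite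

/-- The (unique) minimal generating set of a submonoid of ℕ: the nonzero elements
that are not sums of two nonzero elements. -/
def minGens (Γ : AddSubmonoid ℕ) : Set ℕ :=
  {g | g ∈ Γ ∧ g ≠ 0 ∧ ∀ a ∈ Γ, ∀ b ∈ Γ, a ≠ 0 → b ≠ 0 → g ≠ a + b}

/-- Embedding dimension: the number of minimal generators. -/
noncomputable def edim (Γ : AddSubmonoid ℕ) : ℕ :=
  (minGens Γ).ncard

/-- Multiplicity: the smallest nonzero element. -/
noncomputable def mult (Γ : AddSubmonoid ℕ) : ℕ :=
  sInf {g : ℕ | g ∈ Γ ∧ g ≠ 0}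

/-- The factorization homomorphism φ, sending a formal ℕ-combination of the minimal
generators to its value in ℕ. -/
noncomputable def factorizationHom (Γ : AddSubmonoid ℕ) : (minGens Γ →₀ ℕ) →+ ℕ :=
  Finsupp.liftAddHom fun g => AddMonoidHom.mulLeft (g : ℕ)

/-- The number of minimal relations ρ(Γ): the least cardinality of a set of pairs
generating the kernel congruence of the factorization homomorphism. -/
noncomputable def rho (Γ : AddSubmonoid ℕ) : ℕ :=
  sInf {n : ℕ | ∃ R : Set ((minGens Γ →₀ ℕ) × (minGens Γ →₀ ℕ)),
    R.Finite ∧ R.ncard = n ∧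
    addConGen (fun a b => (a, b) ∈ R) = AddCon.ker (factorizationHom Γ)}

/-- Pseudo-Frobenius numbers of Γ. -/
def pseudoFrobenius (Γ : AddSubmonoid ℕ) : Set ℕ :=
  {p | p ∉ Γ ∧ ∀ g ∈ Γ, g ≠ 0 → p + g ∈ Γ}

/-- The type of Γ: the number of pseudo-Frobenius numbers. -/
noncomputable def numType (Γ : AddSubmonoid ℕ) : ℕ :=
  (pseudoFrobenius Γ).ncard

/-- The Apéry set of Γ with respect to its multiplicity. -/
def aperySet (Γ : AddSubmonoid ℕ) : Set ℕ :=
  {g | g ∈ Γ ∧ ¬ ∃ γ ∈ Γ, g = γ + mult Γ}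

/-- The Macaulay upper function: if `n = C(n_d,d) + ⋯ + C(n_j,j)` is the Macaulay
expansion of `n`, then `macUpper d n = C(n_d+1,d+1) + ⋯ + C(n_j+1,j+1)`, i.e. `n^⟨d⟩`. -/
noncomputable def macUpper : ℕ → ℕ → ℕ
  | 0, _ => 0
  | d + 1, n =>
    if n = 0 then 0
    else
      Nat.choose (sSup {a : ℕ | Nat.choose a (d + 1) ≤ n} + 1) (d + 2) +
        macUpper d (n - Nat.choose (sSup {a : ℕ | Nat.choose a (d + 1) ≤ n}) (d + 1))

/-- The Macaulay lower function: if `n = C(n_d,d) + ⋯ + C(n_j,j)` is the Macaulay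
expansion of `n`, then `macLower d n = C(n_d-1,d) + ⋯ + C(n_j-1,j)`, i.e. `n_⟨d⟩`. -/
noncomputable def macLower : ℕ → ℕ → ℕ
  | 0, _ => 0
  | d + 1, n =>
    if n = 0 then 0
    else
      Nat.choose (sSup {a : ℕ | Nat.choose a (d + 1) ≤ n} - 1) (d + 1) +
        macLower d (n - Nat.choose (sSup {a : ℕ | Nat.choose a (d + 1) ≤ n}) (d + 1))

/-- The unique positive `r` with `C(e+r-1,r-1) ≤ m < C(e+r,r)`. -/
noncomputable def macR (e m : ℕ) : ℕ :=
  sInf {r : ℕ | 0 < r ∧ m < Nat.choose (e + r) r}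

/-- The bound 𝒞(e,m) = C(e+r-1,r) + s^⟨r⟩ - s, where s = m - C(e+r-1,r-1). -/
noncomputable def mathcalC (e m : ℕ) : ℕ :=
  Nat.choose (e + macR e m - 1) (macR e m) +
      macUpper (macR e m) (m - Nat.choose (e + macR e m - 1) (macR e m - 1)) -
    (m - Nat.choose (e + macR e m - 1) (macR e m - 1))

/-- The bound 𝒟(e,m) = C(e+r-2,r-1) + s_⟨r⟩, where s = m - C(e+r-1,r-1). -/
noncomputable def mathcalD (e m : ℕ) : ℕ :=
  Nat.choose (e + macR e m - 2) (macR e m - 1) +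
    macLower (macR e m) (m - Nat.choose (e + macR e m - 1) (macR e m - 1))

open Finset in
/-- A set of nonzero elements of `ZMod 11` whose pairwise sums are distinct, nonzero and
outside the set does not have three elements. -/
theorem card_ne_three_of_injOn_add (N : Finset (ZMod 11)) (h0 : (0 : ZMod 11) ∉ N)
    (hN : ∀ x ∈ N, ∀ y ∈ N, x + y ∉ N ∧ x + y ≠ 0)
    (hinj : ∀ x ∈ N, ∀ y ∈ N, ∀ z ∈ N, ∀ t ∈ N, x + y = z + t →
      (x = z ∧ y = t) ∨ (x = t ∧ y = z)) : #N ≠ 3 := by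
  intro h3
  set T := insert 0 N with hT
  have hT4 : #T = 4 := by rw [hT, card_insert_of_notMem h0, h3]
  have hlt : #(univ.erase (0 : ZMod 11)) < #T.offDiag := by
    rw [offDiag_card, hT4, card_erase_of_mem (mem_univ _), card_univ, ZMod.card]
    norm_num
  obtain ⟨⟨x, y⟩, hxy, ⟨z, t⟩, hzt, hne, heq⟩ :=
    exists_ne_map_eq_of_card_lt_of_maps_to (f := fun p : ZMod 11 × ZMod 11 => p.1 - p.2) hlt
      (by
        rintro ⟨x, y⟩ h
        simp only [coe_offDiag, Set.mem_offDiag] at h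
        simpa [sub_eq_zero] using h.2.2)
  simp only [mem_offDiag, hT, mem_insert] at hxy hzt
  have hsum : x + t = z + y := by linear_combination heq
  obtain ⟨hx, hy, hxy⟩ := hxy
  obtain ⟨hz, ht, hzt⟩ := hzt
  rcases hx with rfl | hx <;> rcases hy with rfl | hy <;> rcases hz with rfl | hz <;>
    rcases ht with rfl | ht <;> grind

open Finset in
/-- For a weight on `ZMod 11`, if at most four nonzero residues do not
split as a sum along which the weight is additive, then at most six nonzero residues are
maximal for the induced order. -/
theorem card_maximal_le_six (w : ZMod 11 → ℕ)
    (hA : #{i : ZMod 11 | i ≠ 0 ∧ ∀ j k, j ≠ 0 → k ≠ 0 → j + k = i → w i ≠ w j + w k} ≤ 4) :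
    #{i : ZMod 11 | i ≠ 0 ∧ ∀ j, j ≠ 0 → w (i + j) ≠ w i + w j} ≤ 6 := by
  set A : Finset (ZMod 11) :=
    {i | i ≠ 0 ∧ ∀ j k, j ≠ 0 → k ≠ 0 → j + k = i → w i ≠ w j + w k} with hAdef
  set M : Finset (ZMod 11) := {i | i ≠ 0 ∧ ∀ j, j ≠ 0 → w (i + j) ≠ w i + w j} with hMdef
  by_contra! hM
  set E : Finset (ZMod 11) := univ.erase 0 with hE
  have hEcard : #E = 10 := by
    rw [hE, card_erase_of_mem (mem_univ _), card_univ, ZMod.card]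
  set N := E \ M with hN
  set B := E \ A with hB
  have hME : M ⊆ E := fun i hi => by
    simp only [hMdef, mem_filter] at hi
    simpa [hE] using hi.2.1
  have hAE : A ⊆ E := fun i hi => by
    simp only [hAdef, mem_filter] at hi
    simpa [hE] using hi.2.1
  have hNcard : #N ≤ 3 := by rw [hN, card_sdiff_of_subset hME]; omega
  have hBcard : 6 ≤ #B := by rw [hB, card_sdiff_of_subset hAE]; omega
  have memN : ∀ i, i ∈ N ↔ i ≠ 0 ∧ ∃ j, j ≠ 0 ∧ w (i + j) = w i + w j := by
    intro i; simp only [hN, hE, hMdef, mem_sdiff, mem_erase, mem_filter, mem_univ]; grind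
  have memB : ∀ i, i ∈ B ↔ i ≠ 0 ∧ ∃ j k, j ≠ 0 ∧ k ≠ 0 ∧ j + k = i ∧ w i = w j + w k := by
    intro i; simp only [hB, hE, hAdef, mem_sdiff, mem_erase, mem_filter, mem_univ]; grind
  have split : ∀ i ∈ B, ∃ j ∈ N, ∃ k ∈ N, j + k = i ∧ w i = w j + w k := by
    intro i hi
    obtain ⟨-, j, k, hj, hk, rfl, hw⟩ := (memB i).1 hi
    exact ⟨j, (memN j).2 ⟨hj, k, hk, hw⟩, k,
      (memN k).2 ⟨hk, j, hj, by rw [add_comm k, hw, add_comm]⟩, rfl, hw⟩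
  let s : Sym2 (ZMod 11) → ZMod 11 := Sym2.lift ⟨fun a b => a + b, fun a b => add_comm a b⟩
  have hsub : B ⊆ N.sym2.image s := by
    intro i hi
    obtain ⟨j, hj, k, hk, h, -⟩ := split i hi
    exact mem_image.2 ⟨s(j, k), mk_mem_sym2_iff.2 ⟨hj, hk⟩, h⟩
  have hsym : #N.sym2 = (#N + 1).choose 2 := card_sym2 N
  have hsym6 : #N.sym2 ≤ 6 := hsym.trans_le (Nat.choose_le_choose 2 (by omega : #N + 1 ≤ 4))
  have hle := card_le_card hsub
  have hle' : #(N.sym2.image s) ≤ #N.sym2 := card_image_le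
  have hBeq : B = N.sym2.image s := eq_of_subset_of_card_le hsub (by omega)
  have hinj : Set.InjOn s N.sym2 := card_image_iff.1 (by omega)
  have hN3 : #N = 3 := by
    have h6 : (#N + 1).choose 2 = 6 := by omega
    interval_cases h : #N <;> simp_all [Nat.choose]
  have inj : ∀ x ∈ N, ∀ y ∈ N, ∀ z ∈ N, ∀ t ∈ N, x + y = z + t →
      (x = z ∧ y = t) ∨ (x = t ∧ y = z) := by
    intro x hx y hy z hz t ht h
    have := hinj (mem_coe.2 (mk_mem_sym2_iff.2 ⟨hx, hy⟩))
      (mem_coe.2 (mk_mem_sym2_iff.2 ⟨hz, ht⟩)) h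
    simpa using this
  have sumB : ∀ x ∈ N, ∀ y ∈ N, x + y ∈ B := by
    intro x hx y hy
    rw [hBeq]
    exact mem_image.2 ⟨s(x, y), mk_mem_sym2_iff.2 ⟨hx, hy⟩, rfl⟩
  have additive : ∀ x ∈ N, ∀ y ∈ N, w (x + y) = w x + w y := by
    intro x hx y hy
    obtain ⟨j, hj, k, hk, h, hw⟩ := split _ (sumB x hx y hy)
    rcases inj j hj k hk x hx y hy h with ⟨rfl, rfl⟩ | ⟨rfl, rfl⟩ <;> omega
  have disj : ∀ y ∈ N, y ∉ B := by
    intro y hy hyB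
    obtain ⟨x, hx, z, hz, hxz, hw⟩ := split y hyB
    have hx0 := ((memN x).1 hx).1
    have hz0 := ((memN z).1 hz).1
    have hzy := additive z hz y hy
    have hyy := additive y hy y hy
    have hsum : (z + y) + x = y + y := by rw [← hxz]; ring
    have hzyN : z + y ∈ N := by
      refine (memN _).2 ⟨((memB _).1 (sumB z hz y hy)).1, x, hx0, ?_⟩
      rw [hsum]; omega
    rcases inj _ hzyN x hx y hy y hy hsum with h | h <;> exact hz0 (by simpa using h.1)
  refine card_ne_three_of_injOn_add N (fun h => ((memN 0).1 h).1 rfl) (fun x hx y hy => ?_) inj hN3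
  exact ⟨fun h => disj _ h (sumB x hx y hy), ((memB _).1 (sumB x hx y hy)).1⟩

theorem exists_mem_natCast_eq {Γ : AddSubmonoid ℕ} (hΓ : IsNumericalMonoid Γ) (m : ℕ) [NeZero m]
    (i : ZMod m) : ∃ n ∈ Γ, (n : ZMod m) = i := by
  by_contra! h
  refine (Set.infinite_of_injective_forall_mem (f := fun k : ℕ => i.val + m * k)
    (fun a b hab => ?_) (fun k => ?_)) hΓ
  · simpa [NeZero.ne m] using hab
  · exact fun hk => h _ hk (by simp)

/-- The least element of `Γ` in a given residue class modulo `m`. -/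
noncomputable def leastInClass (Γ : AddSubmonoid ℕ) (m : ℕ) (i : ZMod m) : ℕ :=
  sInf {n : ℕ | n ∈ Γ ∧ (n : ZMod m) = i}

theorem leastInClass_mem {Γ : AddSubmonoid ℕ} (hΓ : IsNumericalMonoid Γ) (m : ℕ) [NeZero m]
    (i : ZMod m) : leastInClass Γ m i ∈ Γ ∧ (leastInClass Γ m i : ZMod m) = i :=
  Nat.sInf_mem (s := {n : ℕ | n ∈ Γ ∧ (n : ZMod m) = i}) (exists_mem_natCast_eq hΓ m i)

theorem leastInClass_le {Γ : AddSubmonoid ℕ} {m n : ℕ} (hn : n ∈ Γ) :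
    leastInClass Γ m n ≤ n :=
  Nat.sInf_le ⟨hn, rfl⟩

theorem leastInClass_add_le {Γ : AddSubmonoid ℕ} (hΓ : IsNumericalMonoid Γ) (m : ℕ) [NeZero m]
    (i j : ZMod m) :
    leastInClass Γ m (i + j) ≤ leastInClass Γ m i + leastInClass Γ m j := by
  have hi := leastInClass_mem hΓ m i
  have hj := leastInClass_mem hΓ m j
  have h := leastInClass_le (m := m) (Γ.add_mem hi.1 hj.1)
  rwa [Nat.cast_add, hi.2, hj.2] at h

theorem leastInClass_zero (Γ : AddSubmonoid ℕ) (m : ℕ) : leastInClass Γ m 0 = 0 := by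
  simpa using leastInClass_le (m := m) Γ.zero_mem

theorem leastInClass_ne_zero {Γ : AddSubmonoid ℕ} (hΓ : IsNumericalMonoid Γ) {m : ℕ} [NeZero m]
    {i : ZMod m} (hi : i ≠ 0) : leastInClass Γ m i ≠ 0 := by
  intro h
  have := (leastInClass_mem hΓ m i).2
  rw [h] at this
  exact hi (by simpa using this.symm)

/-- A pseudo-Frobenius number `p` is `w - m`, with `w` the Apéry element in its class. -/
theorem leastInClass_of_mem_pseudoFrobenius {Γ : AddSubmonoid ℕ} (hΓ : IsNumericalMonoid Γ)
    {m : ℕ} [NeZero m] (hm : m ∈ Γ) {p : ℕ} (hp : p ∈ pseudoFrobenius Γ) :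
    leastInClass Γ m p = p + m := by
  obtain ⟨hpΓ, hpadd⟩ := hp
  have hle := leastInClass_le (m := m) (hpadd m hm (NeZero.ne m))
  rw [Nat.cast_add, ZMod.natCast_self, add_zero] at hle
  obtain ⟨hwΓ, hw⟩ := leastInClass_mem hΓ m (p : ZMod m)
  set w := leastInClass Γ m p
  have hmod : w ≡ p [MOD m] := (ZMod.natCast_eq_natCast_iff _ _ _).1 hw
  have hlt : p < w := by
    by_contra! h
    obtain ⟨k, hk⟩ := (Nat.modEq_iff_dvd' h).1 hmod
    refine hpΓ ?_
    rw [show p = w + k • m by rw [smul_eq_mul, mul_comm, ← hk]; omega]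
    exact Γ.add_mem hwΓ (Γ.nsmul_mem hm k)
  have hdvd := (Nat.modEq_iff_dvd' hlt.le).1 hmod.symm
  have := Nat.le_of_dvd (by omega) hdvd
  omega

theorem mult_mem {Γ : AddSubmonoid ℕ} (h : mult Γ ≠ 0) : mult Γ ∈ Γ :=
  (Nat.sInf_mem (Nat.nonempty_of_pos_sInf (Nat.pos_of_ne_zero h))).1

theorem mult_le {Γ : AddSubmonoid ℕ} {g : ℕ} (hg : g ∈ Γ) (h0 : g ≠ 0) : mult Γ ≤ g :=
  Nat.sInf_le ⟨hg, h0⟩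

theorem numType_le_six {Γ : AddSubmonoid ℕ} (hΓ : IsNumericalMonoid Γ) (he : edim Γ = 5)
    (hm : mult Γ = 11) : numType Γ ≤ 6 := by
  have h11 : 11 ∈ Γ := hm ▸ mult_mem (by omega)
  have hge : ∀ g ∈ Γ, g ≠ 0 → 11 ≤ g := fun g hg h0 => hm ▸ mult_le hg h0
  set w := leastInClass Γ 11
  have wcast : ∀ i, (w i : ZMod 11) = i := fun i => (leastInClass_mem hΓ 11 i).2
  have wmem : ∀ i, w i ∈ Γ := fun i => (leastInClass_mem hΓ 11 i).1
  have w0 : w 0 = 0 := leastInClass_zero Γ 11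
  have wpos : ∀ i, i ≠ 0 → w i ≠ 0 := fun i hi => leastInClass_ne_zero hΓ hi
  have winj : Function.Injective w := fun i j h => by rw [← wcast i, h, wcast]
  refine le_trans ?_ (card_maximal_le_six w ?_)
  · rw [numType, ← Set.ncard_coe_finset]
    refine Set.ncard_le_ncard_of_injOn (fun p : ℕ => (p : ZMod 11)) (fun p hp => ?_)
      (fun p hp q hq hpq => ?_) (Finset.finite_toSet _)
    · have hwp : w p = p + 11 := leastInClass_of_mem_pseudoFrobenius hΓ h11 hp
      simp only [Finset.coe_filter, Finset.mem_univ, true_and, Set.mem_ofPred_eq]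
      refine ⟨fun h => ?_, fun j hj hadd => ?_⟩
      · rw [h, w0] at hwp
        omega
      · have hle : w _ ≤ _ := leastInClass_le (m := 11) (hp.2 _ (wmem j) (wpos j hj))
        rw [Nat.cast_add, wcast] at hle
        omega
    · have h1 : w p = p + 11 := leastInClass_of_mem_pseudoFrobenius hΓ h11 hp
      have h2 : w q = q + 11 := leastInClass_of_mem_pseudoFrobenius hΓ h11 hq
      have h3 : (p : ZMod 11) = q := hpq
      rw [h3] at h1
      omega
  · set A : Finset (ZMod 11) :=
      {i | i ≠ 0 ∧ ∀ j k, j ≠ 0 → k ≠ 0 → j + k = i → w i ≠ w j + w k} with hA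
    have hfin : (minGens Γ).Finite := Set.finite_of_ncard_ne_zero (by rw [← edim, he]; norm_num)
    have hnot : 11 ∉ A.image w := by
      simp only [Finset.mem_image, not_exists, not_and]
      intro i hi h
      have := wcast i
      rw [h] at this
      exact (Finset.mem_filter.1 hi).2.1 (this.symm.trans (ZMod.natCast_self 11))
    have hsub : ((insert 11 (A.image w) : Finset ℕ) : Set ℕ) ⊆ minGens Γ := by
      intro g hg
      rcases Finset.mem_insert.1 (Finset.mem_coe.1 hg) with rfl | hg
      · refine ⟨h11, by norm_num, fun a ha b hb ha0 hb0 => ?_⟩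
        have := hge a ha ha0
        have := hge b hb hb0
        omega
      · obtain ⟨i, hi, rfl⟩ := Finset.mem_image.1 hg
        obtain ⟨hi0, hi⟩ := (Finset.mem_filter.1 hi).2
        refine ⟨wmem i, wpos i hi0, fun a ha b hb ha0 hb0 hab => ?_⟩
        have hij : (a : ZMod 11) + b = i := by rw [← wcast i, hab, Nat.cast_add]
        have hle : w (a + b) ≤ w a + w b := leastInClass_add_le hΓ 11 _ _
        have hwa : w a ≤ a := leastInClass_le ha
        have hwb : w b ≤ b := leastInClass_le hb
        rw [hij] at hle
        refine hi a b (fun h => ?_) (fun h => ?_) hij (by omega)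
        · rw [h, w0] at hle hwa
          omega
        · rw [h, w0] at hle hwb
          omega
    have hcard := Set.ncard_le_ncard hsub hfin
    rw [Set.ncard_coe_finset, Finset.card_insert_of_notMem hnot,
      Finset.card_image_of_injective _ winj, ← edim, he] at hcard
    omega

theorem mem_closure_generators_iff (n : ℕ) :
    n ∈ AddSubmonoid.closure ({11, 12, 14, 15, 20} : Set ℕ) ↔
      n = 0 ∨ n = 11 ∨ n = 12 ∨ n = 14 ∨ n = 15 ∨ n = 20 ∨ 22 ≤ n := by
  constructor
  · intro h
    induction h using AddSubmonoid.closure_induction with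
    | mem x hx => simp only [Set.mem_insert_iff, Set.mem_singleton_iff] at hx; omega
    | zero => simp
    | add x y _ _ hx hy => omega
  · set S := AddSubmonoid.closure ({11, 12, 14, 15, 20} : Set ℕ)
    have h11 : 11 ∈ S := AddSubmonoid.subset_closure (by simp)
    have h12 : 12 ∈ S := AddSubmonoid.subset_closure (by simp)
    have h14 : 14 ∈ S := AddSubmonoid.subset_closure (by simp)
    have h15 : 15 ∈ S := AddSubmonoid.subset_closure (by simp)
    have h20 : 20 ∈ S := AddSubmonoid.subset_closure (by simp)
    induction n using Nat.strong_induction_on with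
    | _ n ih =>
      intro h
      by_cases hn : 33 ≤ n
      · have := S.add_mem (ih (n - 11) (by omega) (by omega)) h11
        rwa [Nat.sub_add_cancel (by omega)] at this
      · rcases h with rfl | rfl | rfl | rfl | rfl | rfl | h
        · exact S.zero_mem
        all_goals try assumption
        interval_cases n
        · exact S.add_mem h11 h11
        · exact S.add_mem h11 h12
        · exact S.add_mem h12 h12
        · exact S.add_mem h11 h14
        · exact S.add_mem h12 h14
        · exact S.add_mem h12 h15
        · exact S.add_mem h14 h14
        · exact S.add_mem h14 h15
        · exact S.add_mem h15 h15
        · exact S.add_mem h11 h20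
        · exact S.add_mem h12 h20

theorem minGens_closure_generators :
    minGens (AddSubmonoid.closure {11, 12, 14, 15, 20}) =
      (({11, 12, 14, 15, 20} : Finset ℕ) : Set ℕ) := by
  ext g
  simp only [minGens, mem_closure_generators_iff, Set.mem_ofPred_eq, Finset.coe_insert,
    Finset.coe_singleton, Set.mem_insert_iff, Set.mem_singleton_iff]
  constructor
  · rintro ⟨hg, hg0, h⟩
    by_contra hne
    by_cases h33 : 33 ≤ g
    · exact h 11 (by omega) (g - 11) (by omega) (by omega) (by omega) (by omega)
    · by_cases h31 : 31 ≤ g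
      · exact h 20 (by omega) (g - 20) (by omega) (by omega) (by omega) (by omega)
      · by_cases h26 : g = 22 ∨ g = 23 ∨ g = 25
        · exact h 11 (by omega) (g - 11) (by omega) (by omega) (by omega) (by omega)
        · by_cases h27 : g = 24 ∨ g = 26 ∨ g = 27
          · exact h 12 (by omega) (g - 12) (by omega) (by omega) (by omega) (by omega)
          · by_cases h28 : g = 28
            · exact h 14 (by omega) (g - 14) (by omega) (by omega) (by omega) (by omega)
            · exact h 15 (by omega) (g - 15) (by omega) (by omega) (by omega) (by omega)
  · intro hg
    exact ⟨by omega, by omega, fun a ha b hb ha0 hb0 => by omega⟩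

theorem pseudoFrobenius_closure_generators :
    pseudoFrobenius (AddSubmonoid.closure {11, 12, 14, 15, 20}) =
      (({13, 16, 17, 18, 19, 21} : Finset ℕ) : Set ℕ) := by
  ext p
  simp only [pseudoFrobenius, mem_closure_generators_iff, Set.mem_ofPred_eq, Finset.coe_insert,
    Finset.coe_singleton, Set.mem_insert_iff, Set.mem_singleton_iff]
  constructor
  · rintro ⟨hp, h⟩
    have h11 := h 11 (by omega) (by omega)
    have h12 := h 12 (by omega) (by omega)
    have h14 := h 14 (by omega) (by omega)
    omega
  · intro hp
    exact ⟨by omega, fun g hg hg0 => by omega⟩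

theorem mult_closure_generators : mult (AddSubmonoid.closure {11, 12, 14, 15, 20}) = 11 := by
  refine IsLeast.csInf_eq ⟨?_, fun g hg => ?_⟩
  · simp [mem_closure_generators_iff]
  · simp only [mem_closure_generators_iff, Set.mem_ofPred_eq] at hg
    omega

theorem isNumericalMonoid_closure_generators :
    IsNumericalMonoid (AddSubmonoid.closure {11, 12, 14, 15, 20}) := by
  refine (Set.finite_lt_nat 22).subset fun n hn => ?_
  simp only [Set.mem_compl_iff, SetLike.mem_coe, mem_closure_generators_iff] at hn
  simp only [Set.mem_ofPred_eq]
  omega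

/-- 𝒯(4,11) = 6 = 𝒟(4,11) - 1: every numerical monoid with embedding dimension 5
and multiplicity 11 has type at most 6, and ⟨11,12,14,15,20⟩ attains 6. -/
theorem type_max_edim5_mult11 :
    (∀ Γ : AddSubmonoid ℕ, IsNumericalMonoid Γ →
      edim Γ = 5 → mult Γ = 11 → numType Γ ≤ 6) ∧
    IsNumericalMonoid (AddSubmonoid.closure {11, 12, 14, 15, 20}) ∧
    edim (AddSubmonoid.closure {11, 12, 14, 15, 20}) = 5 ∧
    mult (AddSubmonoid.closure {11, 12, 14, 15, 20}) = 11 ∧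
    numType (AddSubmonoid.closure {11, 12, 14, 15, 20}) = 6 := by
  refine ⟨fun Γ hΓ he hm => numType_le_six hΓ he hm, isNumericalMonoid_closure_generators, ?_,
    mult_closure_generators, ?_⟩
  · rw [edim, minGens_closure_generators, Set.ncard_coe_finset]
    rfl
  · rw [numType, pseudoFrobenius_closure_generators, Set.ncard_coe_finset]
    rfl
end

section
/- For all integers e ≥ 3 and k with k ≥ 3 + 3√e (as real numbers), one has binom(e+k+1, k+1) < binom(e+k−1, k−1) + e·binom(e+k−2, k−1). -/
open scoped Pointwise

/-- For e ≥ 3 and k ≥ 3 + 3√e, one has C(e+k+1,k+1) < C(e+k-1,k-1) + e·C(e+k-2,k-1). -/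
theorem choose_ineq_of_large_k (e k : ℕ) (he : 3 ≤ e)
    (hk : (3 : ℝ) + 3 * Real.sqrt e ≤ (k : ℝ)) :
    Nat.choose (e + k + 1) (k + 1) <
      Nat.choose (e + k - 1) (k - 1) + e * Nat.choose (e + k - 2) (k - 1) := by
  have hsq : 9 * (e : ℝ) ≤ ((k : ℝ) - 3) ^ 2 := by
    nlinarith [Real.sq_sqrt (Nat.cast_nonneg (α := ℝ) e), Real.sqrt_nonneg (e : ℝ)]
  have hk1 : 1 ≤ k := by
    have : (1 : ℝ) ≤ k := by linarith [Real.sqrt_nonneg (e : ℝ)]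
    exact_mod_cast this
  obtain ⟨j, rfl⟩ := Nat.exists_eq_add_of_le' hk1
  obtain ⟨f, rfl⟩ := Nat.exists_eq_add_of_le' (le_trans (by norm_num : 1 ≤ 3) he)
  rw [show f + 1 + (j + 1) + 1 = f + j + 3 by omega,
    show f + 1 + (j + 1) - 1 = f + j + 1 by omega,
    show f + 1 + (j + 1) - 2 = f + j by omega, Nat.add_sub_cancel]
  have hA : 0 < (f + j).choose j := Nat.choose_pos (by omega)
  have h₁ := Nat.choose_mul_succ_eq (f + j) j
  rw [show f + j + 1 - j = f + 1 by omega] at h₁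
  have h₂ := Nat.add_one_mul_choose_eq (f + j + 1) j
  have h₃ := Nat.add_one_mul_choose_eq (f + j + 2) (j + 1)
  simp only [Nat.add_assoc, Nat.reduceAdd] at h₁ h₂ h₃ ⊢
  generalize (f + j).choose j = a at *
  generalize (f + (j + 1)).choose j = b at *
  generalize (f + (j + 2)).choose (j + 1) = c at *
  generalize (f + (j + 3)).choose (j + 2) = d at *
  rify at *
  set x : ℝ := (f : ℝ) + 1 with hx
  set y : ℝ := (j : ℝ) + 1 with hy
  have hx3 : 3 ≤ x := by linarith
  have hy3 : 3 ≤ y := by linarith [Real.sqrt_nonneg x]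
  have hf : (f : ℝ) = x - 1 := by linarith
  have hj : (j : ℝ) = y - 1 := by linarith
  simp only [hf, hj] at h₁ h₂ h₃
  have hpoly : (x + y - 1) * (x + 2 * y + 1) < x * y * (y + 1) := by
    nlinarith [mul_le_mul_of_nonneg_left hsq (by linarith : 0 ≤ x),
      mul_nonneg (sub_nonneg.2 hx3) (sq_nonneg y)]
  have hd : d * (x * y * (y + 1)) = a * ((x + y - 1) * (x + y) * (x + y + 1)) := by
    linear_combination (-(x * y)) * h₃ - x * (x + y + 1) * h₂ - (x + y) * (x + y + 1) * h₁
  have hb : b * x = a * (x + y - 1) := by linear_combination -h₁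
  have hpos : 0 < x * y * (y + 1) := by positivity
  refine lt_of_mul_lt_mul_right ?_ hpos.le
  have hdiff : (b + x * a) * (x * y * (y + 1)) - d * (x * y * (y + 1)) =
      a * x * (x * y * (y + 1) - (x + y - 1) * (x + 2 * y + 1)) := by
    linear_combination y * (y + 1) * hb - hd
  have : 0 < a * x * (x * y * (y + 1) - (x + y - 1) * (x + 2 * y + 1)) :=
    mul_pos (by positivity) (sub_pos.2 hpoly)
  linarith
end

section
/- Let t, q, m be integers with t ≥ 2, 0 ≤ q ≤ t−2, and m ≥ 2^t, and define Γ_m = {0} ∪ {m + 2^i − 1 : 0 ≤ i ≤ t−1} ∪ {g ∈ ℕ : g ≥ m + 2^{t−1} + 2^{t−q−1} − 1} ⊆ ℕ. Then Γ_m is a numerical monoid (an additive submonoid of ℕ with finite complement) with multiplicity m and embedding dimension m − binom(t, 2) + q. -/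
open scoped Pointwise

/-- The set Γ_m = {0} ∪ {m + 2^i - 1 : 0 ≤ i ≤ t-1} ∪ {g : g ≥ m + 2^(t-1) + 2^(t-q-1) - 1}. -/
def GammaSet (t q m : ℕ) : Set ℕ :=
  {0} ∪ {x | ∃ i ≤ t - 1, x = m + 2 ^ i - 1} ∪ {g | m + 2 ^ (t - 1) + 2 ^ (t - q - 1) - 1 ≤ g}

lemma two_pow_add_two_pow_inj {i j k l : ℕ} (hij : i ≤ j) (hkl : k ≤ l)
    (h : 2 ^ i + 2 ^ j = 2 ^ k + 2 ^ l) : i = k ∧ j = l := by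
  have key : ∀ {a b c d : ℕ}, a ≤ b → b < d → 2 ^ a + 2 ^ b < 2 ^ c + 2 ^ d := by
    intro a b c d hab hbd
    have h1 : 2 ^ a ≤ 2 ^ b := Nat.pow_le_pow_right two_pos hab
    have h2 : 2 ^ (b + 1) ≤ 2 ^ d := Nat.pow_le_pow_right two_pos hbd
    have h3 : 0 < 2 ^ c := Nat.two_pow_pos c
    rw [pow_succ] at h2
    omega
  have hjl : j = l := by
    rcases lt_trichotomy j l with hlt | heq | hgt
    · exact absurd h (key hij hlt).ne
    · exact heq
    · exact absurd h (key hkl hgt).ne'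
  subst hjl
  exact ⟨Nat.pow_right_injective le_rfl (by simpa using h), rfl⟩

/-- Pairs `(j, i)` with `i ≤ j ≤ s` and, when `j = s`, also `i ≤ d`. -/
def exponentPairs (s d : ℕ) : Finset (Σ _ : ℕ, ℕ) :=
  (Finset.range (s + 1)).sigma fun j => Finset.range (if j = s then d + 1 else j + 1)

/-- The numbers `2 ^ i + 2 ^ j - 2` for `(j, i)` in `exponentPairs s d`. -/
def pairSums (s d : ℕ) : Finset ℕ :=
  (exponentPairs s d).image fun p => 2 ^ p.2 + 2 ^ p.1 - 2

lemma mem_exponentPairs {s d : ℕ} {p : Σ _ : ℕ, ℕ} :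
    p ∈ exponentPairs s d ↔ p.1 ≤ s ∧ (if p.1 = s then p.2 ≤ d else p.2 ≤ p.1) := by
  simp only [exponentPairs, Finset.mem_sigma, Finset.mem_range]
  split_ifs <;> omega

lemma card_exponentPairs (s d : ℕ) :
    (exponentPairs s d).card = (s + 1).choose 2 + (d + 1) := by
  rw [exponentPairs, Finset.card_sigma, Finset.sum_range_succ]
  simp only [Finset.card_range, if_true]
  rw [Finset.sum_congr rfl (g := fun j => j + 1)
    (fun j hj => if_neg (Finset.mem_range.1 hj).ne)]
  congr 1
  induction s with
  | zero => rfl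
  | succ n ih => rw [Finset.sum_range_succ, ih, Nat.choose_succ_succ (n + 1) 1, Nat.choose_one_right,
      add_comm]

lemma card_pairSums {s d : ℕ} (hd : d ≤ s) :
    (pairSums s d).card = (s + 1).choose 2 + (d + 1) := by
  rw [pairSums, Finset.card_image_of_injOn, card_exponentPairs]
  rintro ⟨j, i⟩ hp ⟨l, k⟩ hr h
  have hp' := mem_exponentPairs.1 (Finset.mem_coe.1 hp)
  have hr' := mem_exponentPairs.1 (Finset.mem_coe.1 hr)
  have h1 := Nat.two_pow_pos i
  have h2 := Nat.two_pow_pos j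
  have h3 := Nat.two_pow_pos k
  have h4 := Nat.two_pow_pos l
  simp only at hp' hr' h
  obtain ⟨rfl, rfl⟩ := two_pow_add_two_pow_inj (i := i) (j := j) (k := k) (l := l)
    (by split_ifs at hp' <;> omega) (by split_ifs at hr' <;> omega) (by omega)
  rfl

lemma mem_pairSums {s d x : ℕ} (hd : d ≤ s) :
    x ∈ pairSums s d ↔ x < 2 ^ s + 2 ^ d - 1 ∧
      ∃ i ≤ s, ∃ j ≤ s, x = (2 ^ i - 1) + (2 ^ j - 1) := by
  have hd0 := Nat.two_pow_pos d
  simp only [pairSums, Finset.mem_image, mem_exponentPairs]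
  constructor
  · rintro ⟨⟨j, i⟩, ⟨hj, hi⟩, rfl⟩
    simp only at hj hi ⊢
    have h1 := Nat.two_pow_pos i
    have h2 := Nat.two_pow_pos j
    refine ⟨?_, i, by split_ifs at hi <;> omega, j, hj, by omega⟩
    split_ifs at hi with hjs
    · subst hjs
      have : 2 ^ i ≤ 2 ^ d := Nat.pow_le_pow_right two_pos hi
      omega
    · have h3 : 2 ^ i ≤ 2 ^ j := Nat.pow_le_pow_right two_pos hi
      have h4 : 2 ^ (j + 1) ≤ 2 ^ s := Nat.pow_le_pow_right two_pos (by omega)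
      rw [pow_succ] at h4
      omega
  · rintro ⟨hx, i, hi, j, hj, rfl⟩
    wlog hij : i ≤ j generalizing i j
    · rw [add_comm] at hx ⊢
      exact this j hj i hi hx (by omega)
    have h1 := Nat.two_pow_pos i
    have h2 := Nat.two_pow_pos j
    refine ⟨⟨j, i⟩, ⟨hj, ?_⟩, by simp only; omega⟩
    simp only
    split_ifs with hjs
    · subst hjs
      exact (Nat.pow_le_pow_iff_right one_lt_two).1 (show 2 ^ i ≤ 2 ^ d by omega)
    · exact hij

lemma mem_gammaSet {s q m x : ℕ} :
    x ∈ GammaSet (s + 1) q m ↔ x = 0 ∨ (∃ i ≤ s, x = m + (2 ^ i - 1)) ∨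
      m + (2 ^ s + 2 ^ (s - q) - 1) ≤ x := by
  have h (i : ℕ) : m + 2 ^ i - 1 = m + (2 ^ i - 1) := Nat.add_sub_assoc Nat.one_le_two_pow m
  have h2 : m + 2 ^ s + 2 ^ (s - q) - 1 = m + (2 ^ s + 2 ^ (s - q) - 1) := by
    rw [add_assoc, Nat.add_sub_assoc (Nat.one_le_two_pow.trans (Nat.le_add_right _ _))]
  simp only [GammaSet, Set.mem_union, Set.mem_singleton_iff, Set.mem_ofPred_eq, or_assoc,
    Nat.add_sub_cancel, h, show s + 1 - q - 1 = s - q by omega, h2]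

lemma le_of_mem_gammaSet {s q m x : ℕ} (hx : x ∈ GammaSet (s + 1) q m) (h0 : x ≠ 0) :
    m ≤ x := by
  rcases mem_gammaSet.1 hx with h | ⟨i, -, rfl⟩ | h <;> omega

lemma coe_minGens_eq {s q m : ℕ} (hq : q < s) (hm : 2 ^ (s + 1) ≤ m) {Γ : AddSubmonoid ℕ}
    (hΓ : (Γ : Set ℕ) = GammaSet (s + 1) q m) :
    minGens Γ = (((Finset.range (s + 1)).image fun i => m + (2 ^ i - 1)) ∪
      Finset.Ico (m + (2 ^ s + 2 ^ (s - q) - 1)) (2 * m) ∪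
      (Finset.range (2 ^ s + 2 ^ (s - q) - 1) \ pairSums s (s - q)).image (2 * m + ·) :
        Finset ℕ) := by
  have hmem (x : ℕ) : x ∈ Γ ↔ x = 0 ∨ (∃ i ≤ s, x = m + (2 ^ i - 1)) ∨
      m + (2 ^ s + 2 ^ (s - q) - 1) ≤ x := by
    rw [← SetLike.mem_coe, hΓ, mem_gammaSet]
  have hle (x : ℕ) (hx : x ∈ Γ) (h0 : x ≠ 0) : m ≤ x :=
    le_of_mem_gammaSet (hΓ ▸ SetLike.mem_coe.2 hx) h0
  have hpow (i : ℕ) (hi : i ≤ s) : 2 ^ i ≤ 2 ^ s := Nat.pow_le_pow_right two_pos hi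
  have hd := hpow (s - q) (by omega)
  have hd0 := Nat.two_pow_pos (s - q)
  rw [pow_succ] at hm
  have hmm : m ∈ Γ := (hmem m).2 (.inr (.inl ⟨0, by omega, by simp⟩))
  ext g
  simp only [Finset.coe_union, Finset.coe_image, Set.mem_union, Set.mem_image, Finset.mem_coe,
    Finset.mem_range, Finset.mem_Ico, Finset.mem_sdiff, mem_pairSums (Nat.sub_le s q), or_assoc]
  constructor
  · rintro ⟨hg, hg0, hirr⟩
    rcases (hmem g).1 hg with h | ⟨i, hi, rfl⟩ | h
    · exact absurd h hg0
    · exact .inl ⟨i, by omega, rfl⟩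
    · rcases lt_or_ge g (2 * m) with h2 | h2
      · exact .inr (.inl ⟨h, h2⟩)
      · refine .inr (.inr ⟨g - 2 * m, ⟨?_, ?_⟩, by omega⟩)
        · by_contra hc
          exact hirr m hmm (g - m) ((hmem _).2 (.inr (.inr (by omega)))) (by omega) (by omega)
            (by omega)
        · rintro ⟨-, i, hi, j, hj, hx⟩
          exact hirr (m + (2 ^ i - 1)) ((hmem _).2 (.inr (.inl ⟨i, hi, rfl⟩)))
            (m + (2 ^ j - 1)) ((hmem _).2 (.inr (.inl ⟨j, hj, rfl⟩))) (by omega) (by omega)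
            (by omega)
  · rintro (⟨i, hi, rfl⟩ | ⟨h1, h2⟩ | ⟨x, ⟨hx, hP⟩, rfl⟩)
    · have := hpow i (by omega)
      refine ⟨(hmem _).2 (.inr (.inl ⟨i, by omega, rfl⟩)), by omega, fun a ha b hb ha0 hb0 h => ?_⟩
      have := hle a ha ha0
      have := hle b hb hb0
      omega
    · refine ⟨(hmem _).2 (.inr (.inr h1)), by omega, fun a ha b hb ha0 hb0 h => ?_⟩
      have := hle a ha ha0
      have := hle b hb hb0
      omega
    · refine ⟨(hmem _).2 (.inr (.inr (by omega))), by omega, fun a ha b hb ha0 hb0 h => ?_⟩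
      have hma := hle a ha ha0
      have hmb := hle b hb hb0
      rcases (hmem a).1 ha with h' | ⟨i, hi, rfl⟩ | h'
      · exact ha0 h'
      · rcases (hmem b).1 hb with h' | ⟨j, hj, rfl⟩ | h'
        · exact hb0 h'
        · exact hP ⟨hx, i, hi, j, hj, by omega⟩
        · omega
      · omega

lemma edim_eq_of_coe_eq_gammaSet {s q m : ℕ} (hq : q < s) (hm : 2 ^ (s + 1) ≤ m)
    {Γ : AddSubmonoid ℕ} (hΓ : (Γ : Set ℕ) = GammaSet (s + 1) q m) :
    edim Γ = m - (s + 1).choose 2 + q := by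
  have hpow (i : ℕ) (hi : i ≤ s) : 2 ^ i ≤ 2 ^ s := Nat.pow_le_pow_right two_pos hi
  have hd := hpow (s - q) (by omega)
  have hd2 : 2 ^ 1 ≤ 2 ^ (s - q) := Nat.pow_le_pow_right two_pos (by omega)
  have hsub : pairSums s (s - q) ⊆ Finset.range (2 ^ s + 2 ^ (s - q) - 1) := fun x hx =>
    Finset.mem_range.2 ((mem_pairSums (Nat.sub_le s q)).1 hx).1
  have hcard := Finset.card_le_card hsub
  rw [edim, coe_minGens_eq hq hm hΓ, Set.ncard_coe_finset]
  rw [pow_succ] at hm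
  rw [Finset.card_union_of_disjoint, Finset.card_union_of_disjoint,
    Finset.card_image_of_injective _ (add_right_injective (2 * m)), Finset.card_sdiff_of_subset hsub,
    Finset.card_image_of_injOn, Nat.card_Ico, Finset.card_range, Finset.card_range]
  · rw [card_pairSums (Nat.sub_le s q)] at hcard ⊢
    rw [Finset.card_range] at hcard
    omega
  · intro i _ j _ h
    have h1 := Nat.two_pow_pos i
    have h2 := Nat.two_pow_pos j
    simp only at h
    exact Nat.pow_right_injective le_rfl (show 2 ^ i = 2 ^ j by omega)
  · rw [Finset.disjoint_left]
    simp only [Finset.mem_image, Finset.mem_range, Finset.mem_Ico]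
    rintro _ ⟨i, hi, rfl⟩ h
    have := hpow i (by omega)
    omega
  · rw [Finset.disjoint_left]
    simp only [Finset.mem_union, Finset.mem_image, Finset.mem_range, Finset.mem_Ico]
    rintro _ (⟨i, hi, rfl⟩ | h) ⟨x, -, h'⟩
    · have := hpow i (by omega)
      omega
    · omega

/-- Γ_m is a numerical monoid with multiplicity m and embedding dimension
m - C(t,2) + q. -/
theorem gammaSet_numericalMonoid (t q m : ℕ) (ht : 2 ≤ t) (hq : q ≤ t - 2)
    (hm : 2 ^ t ≤ m) :
    ∃ Γ : AddSubmonoid ℕ, (Γ : Set ℕ) = GammaSet t q m ∧ IsNumericalMonoid Γ ∧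
      mult Γ = m ∧ edim Γ = m - Nat.choose t 2 + q := by
  obtain ⟨s, rfl⟩ : ∃ s, t = s + 1 := ⟨t - 1, by omega⟩
  have hd : 2 ^ (s - q) ≤ 2 ^ s := Nat.pow_le_pow_right two_pos (Nat.sub_le s q)
  have hd0 := Nat.two_pow_pos (s - q)
  have hm' := hm
  rw [pow_succ] at hm'
  let Γ : AddSubmonoid ℕ :=
    { carrier := GammaSet (s + 1) q m
      zero_mem' := mem_gammaSet.2 (.inl rfl)
      add_mem' := by
        intro a b ha hb
        rcases eq_or_ne a 0 with rfl | ha0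
        · simpa using hb
        rcases eq_or_ne b 0 with rfl | hb0
        · simpa using ha
        have := le_of_mem_gammaSet ha ha0
        have := le_of_mem_gammaSet hb hb0
        exact mem_gammaSet.2 (.inr (.inr (by omega))) }
  have hΓ : (Γ : Set ℕ) = GammaSet (s + 1) q m := rfl
  refine ⟨Γ, hΓ, ?_, ?_, edim_eq_of_coe_eq_gammaSet (by omega) hm hΓ⟩
  · refine (Set.finite_Iio (m + (2 ^ s + 2 ^ (s - q) - 1))).subset fun x hx => ?_
    by_contra h
    exact hx (mem_gammaSet.2 (.inr (.inr (not_lt.1 h))))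
  · refine IsLeast.csInf_eq ⟨⟨?_, by omega⟩, fun x hx => le_of_mem_gammaSet hx.1 hx.2⟩
    exact mem_gammaSet.2 (.inr (.inl ⟨0, by omega, by simp⟩))
end

section
/- Let t, q, m be integers with t ≥ 2, 0 ≤ q ≤ t−2, and m ≥ 2^t, and define the numerical monoid Γ_m = {0} ∪ {m + 2^i − 1 : 0 ≤ i ≤ t−1} ∪ {g ∈ ℕ : g ≥ m + 2^{t−1} + 2^{t−q−1} − 1} ⊆ ℕ, which has embedding dimension e+1 where e + 1 = m − binom(t, 2) + q. Then ρ(Γ_m) = binom(e+1, 2) − binom(t, 2) + q + binom(t, 3) + binom(t−q, 2). -/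
open scoped Pointwise

theorem sInf_ncard_addConGen_eq {ι : Type*} (φ : (ι →₀ ℕ) →+ ℕ)
    (hpos : ∀ i, 0 < φ (Finsupp.single i 1)) (o : ι) (C : ℕ)
    (huniq : ∀ f f', φ f = φ f' → φ f < C → f = f')
    (hbig : ∀ n, C ≤ n → ∃ f, φ (f + Finsupp.single o 1) = n)
    (B : Set (ι →₀ ℕ))
    (hB : ∀ f, f ∈ B ↔ f o = 0 ∧ C ≤ φ f ∧ ∀ i, f i ≠ 0 → φ f < C + φ (Finsupp.single i 1))
    (hfin : B.Finite) :
    sInf {n : ℕ | ∃ R : Set ((ι →₀ ℕ) × (ι →₀ ℕ)), R.Finite ∧ R.ncard = n ∧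
      addConGen (fun a b => (a, b) ∈ R) = AddCon.ker φ} = B.ncard := by
  classical
  have hsplit : ∀ (f : ι →₀ ℕ) (i : ι), f i ≠ 0 → ∃ f', f = f' + Finsupp.single i 1 := by
    intro f i hi
    refine ⟨f - Finsupp.single i 1, (tsub_add_cancel_of_le ?_).symm⟩
    rw [Finsupp.single_le_iff]
    omega
  choose! c hc using hbig
  refine IsLeast.csInf_eq ⟨?_, ?_⟩
  · refine ⟨(fun f => (f, c (φ f) + Finsupp.single o 1)) '' B, hfin.image _,
      Set.ncard_image_of_injective _ (fun f g h => (Prod.ext_iff.1 h).1), ?_⟩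
    apply le_antisymm
    · rw [AddCon.addConGen_le]
      rintro _ _ ⟨f, hf, h⟩
      obtain ⟨rfl, rfl⟩ := Prod.ext_iff.1 h
      rw [AddCon.ker_rel]
      exact (hc _ ((hB f).1 hf).2.1).symm
    · set r := addConGen (fun a b => (a, b) ∈
        (fun f => (f, c (φ f) + Finsupp.single o 1)) '' B) with hr
      have key : ∀ n, ∀ f f', φ f = n → φ f' = n → r f f' := by
        intro n
        induction n using Nat.strong_induction_on with
        | _ n ih =>
        have step : ∀ i f f', φ (f + Finsupp.single i 1) = n → φ f = φ f' →
            r (f + Finsupp.single i 1) (f' + Finsupp.single i 1) := by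
          intro i f f' h h'
          have := hpos i
          rw [map_add] at h
          exact r.add (ih (φ f) (by omega) f f' rfl h'.symm) (r.refl _)
        by_cases hn : n < C
        · intro f f' h h'
          rw [huniq f f' (h.trans h'.symm) (h ▸ hn)]
          exact r.refl _
        have hcn := hc n (by omega)
        have hzero : ∀ f, φ (f + Finsupp.single o 1) = n →
            r (f + Finsupp.single o 1) (c n + Finsupp.single o 1) := by
          intro f h
          refine step o f _ h ?_
          have := h.trans hcn.symm
          rw [map_add, map_add] at this
          omega
        have all : ∀ f, φ f = n → r f (c n + Finsupp.single o 1) := by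
          intro f h
          by_cases hfB : f ∈ B
          · refine AddConGen.Rel.of _ _ ⟨f, hfB, ?_⟩
            simp [h]
          by_cases ho : f o = 0
          · have : ∃ i, f i ≠ 0 ∧ C + φ (Finsupp.single i 1) ≤ φ f := by
              by_contra! hcon
              exact hfB ((hB f).2 ⟨ho, by omega, hcon⟩)
            obtain ⟨i, hi, hle⟩ := this
            obtain ⟨f', rfl⟩ := hsplit f i hi
            have hle' : C ≤ φ f' := by
              rw [map_add] at hle
              omega
            have h1 := step i f' _ h (hc _ hle').symm
            refine r.trans h1 ?_
            rw [add_right_comm]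
            apply hzero
            rw [add_right_comm, map_add, hc _ hle', ← map_add, h]
          · obtain ⟨f', rfl⟩ := hsplit f o ho
            exact hzero f' h
        intro f f' h h'
        exact r.trans (all f h) (r.symm (all f' h'))
      intro f f' h
      exact key _ f f' h rfl
  · rintro n ⟨R, hR, rfl, hgen⟩
    let ψ : (ι →₀ ℕ) → (B →₀ ℚ) := fun f =>
      if h : f ∈ B then Finsupp.single ⟨f, h⟩ 1 else 0
    let d : (ι →₀ ℕ) × (ι →₀ ℕ) → (B →₀ ℚ) := fun p => ψ p.1 - ψ p.2
    let W := Submodule.span ℚ (d '' R)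
    have hψ : ∀ f, f ∉ B → ψ f = 0 := fun f h => dif_neg h
    have hvanish : ∀ x y z, φ x = φ y → x ≠ y → z ≠ 0 → ψ (x + z) = 0 := by
      intro x y z hxy hne hz
      refine hψ _ fun hmem => hne ?_
      obtain ⟨i, hi⟩ := Finsupp.ne_iff.1 hz
      have h1 := ((hB _).1 hmem).2.2 i (by
        simp only [Finsupp.coe_zero, Pi.zero_apply] at hi
        simp [hi])
      obtain ⟨z', rfl⟩ := hsplit z i hi
      rw [map_add, map_add] at h1
      exact huniq x y hxy (by omega)
    have htrans : ∀ z x y, φ x = φ y → ψ x - ψ y ∈ W → ψ (x + z) - ψ (y + z) ∈ W := by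
      intro z x y hxy h
      by_cases hz : z = 0
      · simpa [hz] using h
      by_cases hne : x = y
      · simp [hne]
      rw [hvanish x y z hxy hne hz, hvanish y x z hxy.symm (Ne.symm hne) hz, sub_zero]
      exact W.zero_mem
    let S : AddCon (ι →₀ ℕ) :=
      { r := fun x y => φ x = φ y ∧ ψ x - ψ y ∈ W
        iseqv :=
          { refl := fun x => ⟨rfl, by simp⟩
            symm := fun {x y} h => ⟨h.1.symm, by
              rw [← neg_sub]
              exact W.neg_mem h.2⟩
            trans := fun {x y z} h h' => ⟨h.1.trans h'.1, by
              rw [← sub_add_sub_cancel (ψ x) (ψ y) (ψ z)]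
              exact W.add_mem h.2 h'.2⟩ }
        add' := fun {w x y z} h h' => ⟨by rw [map_add, map_add, h.1, h'.1], by
          rw [← sub_add_sub_cancel (ψ (w + y)) (ψ (x + y)) (ψ (x + z)), add_comm x y,
            add_comm x z]
          refine W.add_mem ?_ (htrans x y z h'.1 h'.2)
          rw [add_comm y x]
          exact htrans y w x h.1 h.2⟩ }
    have hle : AddCon.ker φ ≤ S := by
      rw [← hgen, AddCon.addConGen_le]
      intro x y hxy
      refine ⟨?_, Submodule.subset_span ⟨(x, y), hxy, rfl⟩⟩
      have : addConGen (fun a b => (a, b) ∈ R) x y := AddConGen.Rel.of _ _ hxy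
      rw [hgen] at this
      exact this
    have htop : W = ⊤ := by
      rw [eq_top_iff, ← Finsupp.basisSingleOne.span_eq, Submodule.span_le]
      rintro _ ⟨⟨b, hb⟩, rfl⟩
      have hb' := (hB b).1 hb
      have h := (hle (show AddCon.ker φ b _ from (hc _ hb'.2.1).symm)).2
      have hnot : c (φ b) + Finsupp.single o 1 ∉ B := fun hmem => by
        have := ((hB _).1 hmem).1
        simp at this
      rw [hψ _ hnot, sub_zero] at h
      simpa [ψ, hb] using h
    have := hfin.fintype
    have hfin' : (d '' R).Finite := hR.image d
    have := hfin'.fintype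
    have hcard := finrank_span_le_card (R := ℚ) (d '' R)
    change Module.finrank ℚ W ≤ _ at hcard
    rw [htop, finrank_top, Module.finrank_finsupp_self, ← Nat.card_eq_fintype_card,
      ← Set.ncard_eq_toFinset_card'] at hcard
    exact hcard.trans (Set.ncard_image_le hR)

/-- The multisets of cardinality `n` with all elements in `S`. -/
def multisetsOf (S : Set ℕ) (n : ℕ) : Set (Multiset ℕ) :=
  {s | s.card = n ∧ ∀ x ∈ s, x ∈ S}

theorem multisetsOf_eq_range (S : Set ℕ) (n : ℕ) :
    multisetsOf S n = Set.range fun s : Sym S n => s.toMultiset.map Subtype.val := by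
  ext s
  constructor
  · rintro ⟨hs, hS⟩
    lift s to Multiset S using hS
    exact ⟨⟨s, by simpa using hs⟩, rfl⟩
  · rintro ⟨s, rfl⟩
    refine ⟨by simp, fun x hx => ?_⟩
    obtain ⟨y, -, rfl⟩ := Multiset.mem_map.1 hx
    exact y.2

theorem finite_multisetsOf {S : Set ℕ} (hS : S.Finite) (n : ℕ) : (multisetsOf S n).Finite := by
  have := hS.fintype
  rw [multisetsOf_eq_range]
  exact Set.finite_range _

theorem ncard_multisetsOf {S : Set ℕ} (hS : S.Finite) (n : ℕ) :
    (multisetsOf S n).ncard = S.ncard.multichoose n := by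
  have := hS.fintype
  rw [multisetsOf_eq_range, ← Set.image_univ, Set.ncard_image_of_injective, Set.ncard_univ,
    Nat.card_eq_fintype_card, Sym.card_sym_eq_multichoose, Set.ncard_eq_toFinset_card' S,
    Set.toFinset_card]
  exact (Multiset.map_injective Subtype.val_injective).comp Sym.coe_injective

/-- The multisets of size `n` with elements in `[l, u]` in which every two elements are
exponents with `2 ^ i + 2 ^ j ≤ 2 ^ u + 2 ^ v` (see `pow_add_pow_le_iff`). -/
def smallExponents (u v l n : ℕ) : Set (Multiset ℕ) :=
  multisetsOf (Set.Ico l u) n ∪ (fun s => u ::ₘ s) '' multisetsOf (Set.Icc l v) (n - 1)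

theorem ncard_smallExponents (u v l n : ℕ) :
    (smallExponents u v l (n + 1)).ncard =
      (u - l).multichoose (n + 1) + (v + 1 - l).multichoose n := by
  have hI := Set.finite_Ico l u
  have hJ := Set.finite_Icc l v
  rw [smallExponents, Set.ncard_union_eq _ (finite_multisetsOf hI _)
    ((finite_multisetsOf hJ _).image _), ncard_multisetsOf hI, Set.ncard_image_of_injective,
    ncard_multisetsOf hJ]
  · simp [Set.ncard_eq_toFinset_card']
  · intro s s' h
    exact (Multiset.cons_inj_right u).1 h
  · rw [Set.disjoint_right]
    rintro _ ⟨s, -, rfl⟩ h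
    exact absurd (h.2 u (Multiset.mem_cons_self u s)) (by simp)

theorem finite_smallExponents (u v l n : ℕ) : (smallExponents u v l n).Finite :=
  (finite_multisetsOf (Set.finite_Ico l u) _).union
    ((finite_multisetsOf (Set.finite_Icc l v) _).image _)

theorem pow_add_pow_le_iff {u v i j : ℕ} (hv : v ≤ u) (hi : i ≤ u) (hj : j ≤ u) :
    2 ^ i + 2 ^ j ≤ 2 ^ u + 2 ^ v ↔ (i < u ∧ j < u) ∨ (i = u ∧ j ≤ v) ∨ (j = u ∧ i ≤ v) := by
  have mono : ∀ a b : ℕ, 2 ^ a ≤ 2 ^ b ↔ a ≤ b := fun a b =>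
    Nat.pow_le_pow_iff_right (by norm_num)
  rcases hi.lt_or_eq with hi' | rfl
  · rcases hj.lt_or_eq with hj' | rfl
    · refine iff_of_true ?_ (Or.inl ⟨hi', hj'⟩)
      have h1 := (mono (i + 1) u).2 hi'
      have h2 := (mono (j + 1) u).2 hj'
      rw [pow_succ] at h1 h2
      exact le_trans (by omega : 2 ^ i + 2 ^ j ≤ 2 ^ u) (Nat.le_add_right _ _)
    · rw [add_comm, add_le_add_iff_left, mono]
      omega
  · rw [add_le_add_iff_left, mono]
    omega

theorem pair_eq_of_pow_add_pow_eq {i j k l : ℕ} (h : 2 ^ i + 2 ^ j = 2 ^ k + 2 ^ l) :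
    ({i, j} : Multiset ℕ) = {k, l} := by
  have main : ∀ {i j k l : ℕ}, i ≤ j → k ≤ l → 2 ^ i + 2 ^ j = 2 ^ k + 2 ^ l → j ≤ l := by
    intro i j k l hij hkl h
    by_contra! hlt
    have h1 : 2 ^ (l + 1) ≤ 2 ^ j := Nat.pow_le_pow_right (by norm_num) hlt
    have h2 : 2 ^ k ≤ 2 ^ l := Nat.pow_le_pow_right (by norm_num) hkl
    have h3 : 0 < 2 ^ i := by positivity
    rw [pow_succ] at h1
    omega
  have key : ∀ {i j k l : ℕ}, i ≤ j → k ≤ l → 2 ^ i + 2 ^ j = 2 ^ k + 2 ^ l →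
      ({i, j} : Multiset ℕ) = {k, l} := by
    intro i j k l hij hkl h
    obtain rfl := (main hij hkl h).antisymm (main hkl hij h.symm)
    obtain rfl := Nat.pow_right_injective le_rfl (add_right_cancel h)
    rfl
  rcases le_total i j with hij | hij <;> rcases le_total k l with hkl | hkl
  · exact key hij hkl h
  · rw [Multiset.pair_comm k]
    exact key hij hkl (by omega)
  · rw [Multiset.pair_comm i]
    exact key hij hkl (by omega)
  · rw [Multiset.pair_comm i, Multiset.pair_comm k]
    exact key hij hkl (by omega)

theorem mem_smallExponents_two {u v l : ℕ} (hl : l ≤ u) (hv : v ≤ u) (s : Multiset ℕ) :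
    s ∈ smallExponents u v l 2 ↔ ∃ i j, s = {i, j} ∧ l ≤ i ∧ i ≤ u ∧ l ≤ j ∧ j ≤ u ∧
      2 ^ i + 2 ^ j ≤ 2 ^ u + 2 ^ v := by
  constructor
  · rintro (⟨hc, h⟩ | ⟨s', ⟨hc, h⟩, rfl⟩)
    · obtain ⟨i, j, rfl⟩ := Multiset.card_eq_two.1 hc
      simp only [Multiset.insert_eq_cons, Multiset.mem_cons, Multiset.mem_singleton,
        forall_eq_or_imp, forall_eq, Set.mem_Ico] at h
      exact ⟨i, j, rfl, by omega, by omega, by omega, by omega,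
        (pow_add_pow_le_iff hv (by omega) (by omega)).2 (by omega)⟩
    · obtain ⟨i, rfl⟩ := Multiset.card_eq_one.1 hc
      simp only [Multiset.mem_singleton, forall_eq, Set.mem_Icc] at h
      exact ⟨u, i, rfl, hl, le_rfl, h.1, by omega,
        (pow_add_pow_le_iff hv le_rfl (by omega)).2 (by omega)⟩
  · rintro ⟨i, j, rfl, h1, h2, h3, h4, h5⟩
    rw [pow_add_pow_le_iff hv h2 h4] at h5
    rcases h5 with h | ⟨rfl, h⟩ | ⟨rfl, h⟩
    · left
      refine ⟨rfl, ?_⟩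
      simp only [Multiset.insert_eq_cons, Multiset.mem_cons, Multiset.mem_singleton,
        forall_eq_or_imp, forall_eq, Set.mem_Ico]
      omega
    · exact Or.inr ⟨{j}, ⟨rfl, by simp; omega⟩, rfl⟩
    · exact Or.inr ⟨{i}, ⟨rfl, by simp; omega⟩, Multiset.pair_comm _ _⟩

theorem mem_smallExponents_three {u v l : ℕ} (hl : l ≤ u) (hv : v ≤ u) (s : Multiset ℕ) :
    s ∈ smallExponents u v l 3 ↔ ∃ i j k, s = {i, j, k} ∧
      (l ≤ i ∧ i ≤ u) ∧ (l ≤ j ∧ j ≤ u) ∧ (l ≤ k ∧ k ≤ u) ∧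
      2 ^ i + 2 ^ j ≤ 2 ^ u + 2 ^ v ∧ 2 ^ i + 2 ^ k ≤ 2 ^ u + 2 ^ v ∧
      2 ^ j + 2 ^ k ≤ 2 ^ u + 2 ^ v := by
  constructor
  · rintro (⟨hc, h⟩ | ⟨s', ⟨hc, h⟩, rfl⟩)
    · obtain ⟨i, j, k, rfl⟩ := Multiset.card_eq_three.1 hc
      simp only [Multiset.insert_eq_cons, Multiset.mem_cons, Multiset.mem_singleton,
        forall_eq_or_imp, forall_eq, Set.mem_Ico] at h
      refine ⟨i, j, k, rfl, by omega, by omega, by omega, ?_, ?_, ?_⟩ <;>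
        exact (pow_add_pow_le_iff hv (by omega) (by omega)).2 (by omega)
    · obtain ⟨i, j, rfl⟩ := Multiset.card_eq_two.1 hc
      simp only [Multiset.insert_eq_cons, Multiset.mem_cons, Multiset.mem_singleton,
        forall_eq_or_imp, forall_eq, Set.mem_Icc] at h
      refine ⟨u, i, j, rfl, by omega, by omega, by omega, ?_, ?_, ?_⟩ <;>
        exact (pow_add_pow_le_iff hv (by omega) (by omega)).2 (by omega)
  · rintro ⟨i, j, k, rfl, h1, h2, h3, h4, h5, h6⟩
    rw [pow_add_pow_le_iff hv (by omega) (by omega)] at h4 h5 h6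
    have hcase : (i < u ∧ j < u ∧ k < u) ∨ (i = u ∧ j ≤ v ∧ k ≤ v) ∨
        (j = u ∧ i ≤ v ∧ k ≤ v) ∨ (k = u ∧ i ≤ v ∧ j ≤ v) := by omega
    rcases hcase with h | ⟨rfl, h⟩ | ⟨rfl, h⟩ | ⟨rfl, h⟩
    · left
      refine ⟨rfl, ?_⟩
      simp only [Multiset.insert_eq_cons, Multiset.mem_cons, Multiset.mem_singleton,
        forall_eq_or_imp, forall_eq, Set.mem_Ico]
      omega
    · exact Or.inr ⟨{j, k}, ⟨rfl, by simp; omega⟩, rfl⟩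
    · exact Or.inr ⟨{i, k}, ⟨rfl, by simp; omega⟩, Multiset.cons_swap _ _ _⟩
    · refine Or.inr ⟨{i, j}, ⟨rfl, by simp; omega⟩, ?_⟩
      simp only [Multiset.insert_eq_cons]
      rw [Multiset.cons_swap]
      congr 1
      exact Multiset.pair_comm _ _

/-- The explicit minimal generating set of `GammaSet (u + 1) (u - v) m`. -/
def gammaGens (u v m : ℕ) : Set ℕ :=
  {x | (∃ i ≤ u, x + 1 = m + 2 ^ i) ∨ (m + 2 ^ u + 2 ^ v ≤ x + 1 ∧
    x + 1 < 2 * m + 2 ^ u + 2 ^ v ∧ ∀ i ≤ u, ∀ j ≤ u, x + 2 ≠ 2 * m + 2 ^ i + 2 ^ j)}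

theorem le_of_mem_gammaGens {u v m x : ℕ} (hx : x ∈ gammaGens u v m) : m ≤ x := by
  rcases hx with ⟨i, -, hi⟩ | ⟨h, -⟩
  · have := Nat.one_le_two_pow (n := i)
    omega
  · have := Nat.one_le_two_pow (n := u)
    have := Nat.one_le_two_pow (n := v)
    omega

theorem exists_pow_of_add_lt {u v m x y : ℕ} (hx : x ∈ gammaGens u v m)
    (hy : y ∈ gammaGens u v m) (h : x + y + 1 < 2 * m + 2 ^ u + 2 ^ v) :
    ∃ i ≤ u, x + 1 = m + 2 ^ i := by
  have := le_of_mem_gammaGens hy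
  rcases hx with hi | ⟨h', -⟩
  · exact hi
  · omega

theorem lt_of_mem_gammaGens {u v m x : ℕ} (hx : x ∈ gammaGens u v m) :
    x + 1 < 2 * m + 2 ^ u + 2 ^ v := by
  rcases hx with ⟨i, hi, h⟩ | ⟨-, h, -⟩
  · have h1 : 2 ^ i ≤ 2 ^ u := Nat.pow_le_pow_right (by norm_num) hi
    have h2 := Nat.one_le_two_pow (n := v)
    have h3 := Nat.one_le_two_pow (n := u)
    omega
  · exact h

theorem ne_add_of_mem_gammaGens {u v m x y z : ℕ} (hm : 2 * 2 ^ u ≤ m)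
    (hx : x ∈ gammaGens u v m) (hy : y ∈ gammaGens u v m) (hz : z ∈ gammaGens u v m) :
    x ≠ y + z := by
  rintro rfl
  have h1 := le_of_mem_gammaGens hy
  have h2 := le_of_mem_gammaGens hz
  have h3 := Nat.one_le_two_pow (n := u)
  rcases hx with ⟨i, hi, h⟩ | ⟨-, h, h'⟩
  · have : 2 ^ i ≤ 2 ^ u := Nat.pow_le_pow_right (by norm_num) hi
    omega
  · obtain ⟨i, hi, hi'⟩ := exists_pow_of_add_lt hy hz h
    obtain ⟨j, hj, hj'⟩ := exists_pow_of_add_lt hz hy (by rwa [add_comm z])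
    exact h' i hi j hj (by omega)

theorem card_mul_le_sum {u v m : ℕ} {s : Multiset ℕ} (hs : ∀ x ∈ s, x ∈ gammaGens u v m) :
    s.card * m ≤ s.sum := by
  simpa using Multiset.card_nsmul_le_sum fun x hx => le_of_mem_gammaGens (hs x hx)

theorem two_pow_add_le {u v m : ℕ} (hv : v ≤ u) (hm : 2 * 2 ^ u ≤ m) : 2 ^ u + 2 ^ v ≤ m := by
  have : 2 ^ v ≤ 2 ^ u := Nat.pow_le_pow_right (by norm_num) hv
  omega

theorem eq_of_sum_eq {u v m : ℕ} (hv : v ≤ u) (hm : 2 * 2 ^ u ≤ m) {s s' : Multiset ℕ}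
    (hs : ∀ x ∈ s, x ∈ gammaGens u v m) (hs' : ∀ x ∈ s', x ∈ gammaGens u v m)
    (h : s.sum = s'.sum) (hlt : s.sum + 1 < 2 * m + 2 ^ u + 2 ^ v) : s = s' := by
  have hM := two_pow_add_le hv hm
  have hm0 : 0 < m := lt_of_lt_of_le (by positivity) hM
  have hcases : ∀ s : Multiset ℕ, (∀ x ∈ s, x ∈ gammaGens u v m) →
      s.sum + 1 < 2 * m + 2 ^ u + 2 ^ v →
      s = 0 ∨ (∃ x, s = {x}) ∨ ∃ x y, s = {x, y} := by
    intro s hs hlt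
    have := card_mul_le_sum hs
    have hc : s.card < 3 := by
      by_contra! hc
      have := Nat.mul_le_mul_right m hc
      omega
    interval_cases hcs : s.card
    · exact Or.inl (Multiset.card_eq_zero.1 hcs)
    · exact Or.inr (Or.inl (Multiset.card_eq_one.1 hcs))
    · exact Or.inr (Or.inr (Multiset.card_eq_two.1 hcs))
  have hpos : ∀ x ∈ gammaGens u v m, 0 < x := fun x hx => hm0.trans_le (le_of_mem_gammaGens hx)
  rcases hcases s hs hlt with rfl | ⟨x, rfl⟩ | ⟨x, y, rfl⟩ <;>
  rcases hcases s' hs' (h ▸ hlt) with rfl | ⟨z, rfl⟩ | ⟨z, w, rfl⟩ <;>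
  simp only [Multiset.insert_eq_cons, Multiset.mem_cons, Multiset.mem_singleton,
    forall_eq_or_imp, forall_eq, Multiset.sum_cons, Multiset.sum_singleton,
    Multiset.sum_zero] at hs hs' h hlt
  · rfl
  · have := hpos z hs'
    omega
  · have := hpos z hs'.1
    omega
  · have := hpos x hs
    omega
  · rw [h]
  · exact absurd h (ne_add_of_mem_gammaGens hm hs hs'.1 hs'.2)
  · have := hpos x hs.1
    omega
  · exact absurd h.symm (ne_add_of_mem_gammaGens hm hs' hs.1 hs.2)
  · obtain ⟨i, hi, hi'⟩ := exists_pow_of_add_lt hs.1 hs.2 hlt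
    obtain ⟨j, hj, hj'⟩ := exists_pow_of_add_lt hs.2 hs.1 (by rwa [add_comm y])
    obtain ⟨k, hk, hk'⟩ := exists_pow_of_add_lt hs'.1 hs'.2 (h ▸ hlt)
    obtain ⟨l, hl, hl'⟩ := exists_pow_of_add_lt hs'.2 hs'.1 (by rwa [add_comm w, ← h])
    have key := pair_eq_of_pow_add_pow_eq (show 2 ^ i + 2 ^ j = 2 ^ k + 2 ^ l by omega)
    have := congrArg (Multiset.map fun i => m + 2 ^ i - 1) key
    simp only [Multiset.insert_eq_cons, Multiset.map_cons, Multiset.map_singleton] at this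
    rwa [← hi', ← hj', ← hk', ← hl'] at this

theorem injective_add_two_pow_sub_one (m : ℕ) :
    Function.Injective fun i : ℕ => m + 2 ^ i - 1 := by
  intro i j h
  have h1 := Nat.one_le_two_pow (n := i)
  have h2 := Nat.one_le_two_pow (n := j)
  exact Nat.pow_right_injective le_rfl (show 2 ^ i = 2 ^ j by simp only at h; omega)

theorem gammaGens_eq (u v m : ℕ) (hv : v ≤ u) : gammaGens u v m =
    (fun i => m + 2 ^ i - 1) '' Set.Iic u ∪
      (Set.Ico (m + 2 ^ u + 2 ^ v - 1) (2 * m + 2 ^ u + 2 ^ v - 1) \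
        (fun s => (s.map fun i => m + 2 ^ i - 1).sum) '' smallExponents u v 0 2) := by
  ext x
  refine or_congr ?_ ?_
  · refine exists_congr fun i => and_congr_right fun _ => ?_
    have := Nat.one_le_two_pow (n := i)
    change _ ↔ m + 2 ^ i - 1 = x
    omega
  · have h1 := Nat.one_le_two_pow (n := u)
    simp only [Set.mem_sdiff, Set.mem_Ico]
    rw [← and_assoc]
    have hx : m + 2 ^ u + 2 ^ v ≤ x + 1 ∧ x + 1 < 2 * m + 2 ^ u + 2 ^ v ↔
      m + 2 ^ u + 2 ^ v - 1 ≤ x ∧ x < 2 * m + 2 ^ u + 2 ^ v - 1 := by omega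
    rw [hx]
    refine and_congr_right fun h => ?_
    constructor
    · rintro h' ⟨s, hs, rfl⟩
      obtain ⟨i, j, rfl, -, hi, -, hj, -⟩ := (mem_smallExponents_two (Nat.zero_le u) hv s).1 hs
      refine h' i hi j hj ?_
      have h2 := Nat.one_le_two_pow (n := i)
      have h3 := Nat.one_le_two_pow (n := j)
      simp only [Multiset.insert_eq_cons, Multiset.map_cons, Multiset.map_singleton,
        Multiset.sum_cons, Multiset.sum_singleton]
      omega
    · intro h' i hi j hj hij
      refine h' ⟨{i, j}, (mem_smallExponents_two (Nat.zero_le u) hv _).2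
        ⟨i, j, rfl, Nat.zero_le _, hi, Nat.zero_le _, hj, by omega⟩, ?_⟩
      have h2 := Nat.one_le_two_pow (n := i)
      have h3 := Nat.one_le_two_pow (n := j)
      simp only [Multiset.insert_eq_cons, Multiset.map_cons, Multiset.map_singleton,
        Multiset.sum_cons, Multiset.sum_singleton]
      omega

theorem finite_gammaGens (u v m : ℕ) : (gammaGens u v m).Finite :=
  (Set.finite_Iio (2 * m + 2 * 2 ^ u + 2 ^ v)).subset <| by
    rintro x (⟨i, hi, h⟩ | ⟨-, h, -⟩)
    · have : 2 ^ i ≤ 2 ^ u := Nat.pow_le_pow_right (by norm_num) hi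
      have := Nat.one_le_two_pow (n := v)
      rw [Set.mem_Iio]
      omega
    · rw [Set.mem_Iio]
      omega

theorem ncard_gammaGens {u v m : ℕ} (hv : v ≤ u) (hm : 2 * 2 ^ u ≤ m) :
    (smallExponents u v 0 2).ncard ≤ m ∧
      (gammaGens u v m).ncard = u + 1 + (m - (smallExponents u v 0 2).ncard) := by
  have hM := two_pow_add_le hv hm
  have hinj : Set.InjOn (fun s : Multiset ℕ => (s.map fun i => m + 2 ^ i - 1).sum)
      (smallExponents u v 0 2) := by
    intro s hs s' hs' h
    obtain ⟨i, j, rfl, -⟩ := (mem_smallExponents_two (Nat.zero_le u) hv s).1 hs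
    obtain ⟨k, l, rfl, -⟩ := (mem_smallExponents_two (Nat.zero_le u) hv s').1 hs'
    apply pair_eq_of_pow_add_pow_eq
    have h1 := Nat.one_le_two_pow (n := i)
    have h2 := Nat.one_le_two_pow (n := j)
    have h3 := Nat.one_le_two_pow (n := k)
    have h4 := Nat.one_le_two_pow (n := l)
    simp only [Multiset.insert_eq_cons, Multiset.map_cons, Multiset.map_singleton,
      Multiset.sum_cons, Multiset.sum_singleton] at h
    omega
  have hsub : (fun s : Multiset ℕ => (s.map fun i => m + 2 ^ i - 1).sum) ''
      smallExponents u v 0 2 ⊆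
        Set.Ico (m + 2 ^ u + 2 ^ v - 1) (2 * m + 2 ^ u + 2 ^ v - 1) := by
    rintro _ ⟨s, hs, rfl⟩
    obtain ⟨i, j, rfl, -, hi, -, hj, h⟩ := (mem_smallExponents_two (Nat.zero_le u) hv s).1 hs
    have h1 := Nat.one_le_two_pow (n := i)
    have h2 := Nat.one_le_two_pow (n := j)
    simp only [Multiset.insert_eq_cons, Multiset.map_cons, Multiset.map_singleton,
      Multiset.sum_cons, Multiset.sum_singleton, Set.mem_Ico]
    omega
  have hIco : (Set.Ico (m + 2 ^ u + 2 ^ v - 1) (2 * m + 2 ^ u + 2 ^ v - 1)).ncard = m := by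
    have := Nat.one_le_two_pow (n := u)
    have := Nat.one_le_two_pow (n := v)
    rw [Set.ncard_eq_toFinset_card', Set.toFinset_Ico, Nat.card_Ico,
      show 2 * m + 2 ^ u + 2 ^ v - 1 = m + (m + 2 ^ u + 2 ^ v - 1) by omega,
      Nat.add_sub_cancel_right]
  have hle := Set.ncard_le_ncard hsub
  rw [hinj.ncard_image, hIco] at hle
  refine ⟨hle, ?_⟩
  rw [gammaGens_eq u v m hv, Set.ncard_union_eq _ ((Set.finite_Iic u).image _)
    (Set.finite_Ico _ _).sdiff, Set.ncard_image_of_injective _ (injective_add_two_pow_sub_one m),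
    Set.ncard_sdiff hsub ((finite_smallExponents u v 0 2).image _), hIco,
    hinj.ncard_image]
  · simp [Set.ncard_eq_toFinset_card']
  · rw [Set.disjoint_left]
    rintro _ ⟨i, hi, rfl⟩ ⟨⟨h, -⟩, -⟩
    have h1 : 2 ^ i ≤ 2 ^ u := Nat.pow_le_pow_right (by norm_num) hi
    have h2 := Nat.one_le_two_pow (n := v)
    have h3 := Nat.one_le_two_pow (n := i)
    simp only at h
    omega

/-- The multisets of generators other than `m` whose sum reaches the threshold
`2 * m + 2 ^ u + 2 ^ v - 1`, but does not after removing any element. -/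
def minimalMultisets (u v m : ℕ) : Set (Multiset ℕ) :=
  {s | (∀ x ∈ s, x ∈ gammaGens u v m) ∧ m ∉ s ∧ 2 * m + 2 ^ u + 2 ^ v ≤ s.sum + 1 ∧
    ∀ x ∈ s, s.sum + 1 < 2 * m + 2 ^ u + 2 ^ v + x}

theorem minimalMultisets_eq {u v m : ℕ} (hu : 1 ≤ u) (hv : v ≤ u) (hm : 2 * 2 ^ u ≤ m) :
    minimalMultisets u v m =
      (multisetsOf (gammaGens u v m \ {m}) 2 \
        Multiset.map (fun i => m + 2 ^ i - 1) '' smallExponents u v 1 2) ∪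
      Multiset.map (fun i => m + 2 ^ i - 1) '' smallExponents u v 1 3 := by
  have hM := two_pow_add_le hv hm
  have hone : ∀ i : ℕ, 1 ≤ 2 ^ i := fun i => Nat.one_le_two_pow
  have hmem : ∀ i ≤ u, m + 2 ^ i - 1 ∈ gammaGens u v m := fun i hi =>
    Or.inl ⟨i, hi, by have := hone i; omega⟩
  have htwo : ∀ i, 1 ≤ i → 2 ≤ 2 ^ i := fun i hi => by
    simpa using Nat.pow_le_pow_right (n := 2) (by norm_num) hi
  have hexp : ∀ x i, x ≠ m → x + 1 = m + 2 ^ i → 1 ≤ i := by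
    rintro x (_ | i) hx h
    · simp at h
      omega
    · omega
  ext s
  constructor
  · rintro ⟨hs, hsm, hge, hlt⟩
    have hc : s.card < 4 := by
      by_contra! hc
      obtain ⟨x, hx⟩ := Multiset.card_pos_iff_exists_mem.1 (by omega : 0 < s.card)
      obtain ⟨s', rfl⟩ := Multiset.exists_cons_of_mem hx
      have h1 := card_mul_le_sum fun y hy => hs y (Multiset.mem_cons_of_mem hy)
      have h2 := hlt x hx
      rw [Multiset.card_cons] at hc
      have h3 := Nat.mul_le_mul_right m (show 3 ≤ s'.card by omega)
      rw [Multiset.sum_cons] at h2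
      omega
    interval_cases hcs : s.card
    · rw [Multiset.card_eq_zero] at hcs
      subst hcs
      have := hone u
      have := hone v
      simp only [Multiset.sum_zero] at hge
      omega
    · obtain ⟨x, rfl⟩ := Multiset.card_eq_one.1 hcs
      have := lt_of_mem_gammaGens (hs x (Multiset.mem_singleton_self x))
      simp only [Multiset.sum_singleton] at hge
      omega
    · left
      refine ⟨⟨hcs, fun x hx => ⟨hs x hx, fun h => hsm (h ▸ hx)⟩⟩, ?_⟩
      rintro ⟨s', hs', rfl⟩
      obtain ⟨i, j, rfl, -, hi, -, hj, h⟩ := (mem_smallExponents_two hu hv s').1 hs'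
      simp only [Multiset.insert_eq_cons, Multiset.map_cons, Multiset.map_singleton,
        Multiset.sum_cons, Multiset.sum_singleton] at hge
      have := hone i
      have := hone j
      omega
    · right
      obtain ⟨x, y, z, rfl⟩ := Multiset.card_eq_three.1 hcs
      simp only [Multiset.insert_eq_cons, Multiset.mem_cons, Multiset.mem_singleton,
        forall_eq_or_imp, forall_eq, Multiset.sum_cons, Multiset.sum_singleton,
        not_or] at hs hsm hlt
      obtain ⟨i, hi, hi'⟩ := exists_pow_of_add_lt hs.1 hs.2.1 (by omega)
      obtain ⟨j, hj, hj'⟩ := exists_pow_of_add_lt hs.2.1 hs.1 (by omega)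
      obtain ⟨k, hk, hk'⟩ := exists_pow_of_add_lt hs.2.2 hs.1 (by omega)
      refine ⟨{i, j, k}, (mem_smallExponents_three hu hv _).2 ⟨i, j, k, rfl,
        ⟨hexp x i (Ne.symm hsm.1) hi', hi⟩, ⟨hexp y j (Ne.symm hsm.2.1) hj', hj⟩,
        ⟨hexp z k (Ne.symm hsm.2.2) hk', hk⟩, by omega, by omega, by omega⟩, ?_⟩
      simp only [Multiset.insert_eq_cons, Multiset.map_cons, Multiset.map_singleton]
      rw [← hi', ← hj', ← hk']
      rfl
  · rintro (⟨⟨hc, hs⟩, h⟩ | ⟨s', hs', rfl⟩)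
    · obtain ⟨x, y, rfl⟩ := Multiset.card_eq_two.1 hc
      have hx := hs x (by simp)
      have hy := hs y (by simp)
      refine ⟨fun z hz => (hs z hz).1, fun hm' => (hs m hm').2 rfl, ?_, ?_⟩
      · by_contra! hlt
        refine h ?_
        simp only [Multiset.insert_eq_cons, Multiset.sum_cons, Multiset.sum_singleton] at hlt
        obtain ⟨i, hi, hi'⟩ := exists_pow_of_add_lt hx.1 hy.1 hlt
        obtain ⟨j, hj, hj'⟩ := exists_pow_of_add_lt hy.1 hx.1 (by rwa [add_comm y])
        refine ⟨{i, j}, (mem_smallExponents_two hu hv _).2 ⟨i, j, rfl,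
          hexp x i hx.2 hi', hi, hexp y j hy.2 hj', hj, by omega⟩, ?_⟩
        simp only [Multiset.insert_eq_cons, Multiset.map_cons, Multiset.map_singleton]
        rw [← hi', ← hj']
        rfl
      · have h1 := lt_of_mem_gammaGens hx.1
        have h2 := lt_of_mem_gammaGens hy.1
        simp only [Multiset.insert_eq_cons, Multiset.mem_cons, Multiset.mem_singleton,
          forall_eq_or_imp, forall_eq, Multiset.sum_cons, Multiset.sum_singleton]
        omega
    · obtain ⟨i, j, k, rfl, hi, hj, hk, h1, h2, h3⟩ :=
        (mem_smallExponents_three hu hv s').1 hs'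
      have h4 := htwo i hi.1
      have h5 := htwo j hj.1
      have h6 := htwo k hk.1
      refine ⟨?_, ?_, ?_, ?_⟩ <;>
      simp only [Multiset.insert_eq_cons, Multiset.map_cons, Multiset.map_singleton,
        Multiset.mem_cons, Multiset.mem_singleton, forall_eq_or_imp, forall_eq,
        Multiset.sum_cons, Multiset.sum_singleton]
      · exact ⟨hmem i hi.2, hmem j hj.2, hmem k hk.2⟩
      all_goals omega

theorem ncard_minimalMultisets {u v m : ℕ} (hu : 1 ≤ u) (hv : v ≤ u) (hm : 2 * 2 ^ u ≤ m) :
    (minimalMultisets u v m).Finite ∧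
    (minimalMultisets u v m).ncard =
      ((gammaGens u v m).ncard - 1).multichoose 2 - (smallExponents u v 1 2).ncard +
        (smallExponents u v 1 3).ncard := by
  have hinj := Multiset.map_injective (injective_add_two_pow_sub_one m)
  have hfin : (gammaGens u v m \ {m}).Finite := (finite_gammaGens u v m).sdiff
  have hA : m ∈ gammaGens u v m := Or.inl ⟨0, Nat.zero_le _, by simp⟩
  have hone : ∀ i : ℕ, 1 ≤ 2 ^ i := fun i => Nat.one_le_two_pow
  have hmem : ∀ i ≤ u, 1 ≤ i → m + 2 ^ i - 1 ∈ gammaGens u v m \ {m} := fun i hi hi' =>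
    ⟨Or.inl ⟨i, hi, by have := hone i; omega⟩, by
      have : 2 ≤ 2 ^ i := by simpa using Nat.pow_le_pow_right (n := 2) (by norm_num) hi'
      rw [Set.mem_singleton_iff]
      omega⟩
  have hsub : Multiset.map (fun i => m + 2 ^ i - 1) '' smallExponents u v 1 2 ⊆
      multisetsOf (gammaGens u v m \ {m}) 2 := by
    rintro _ ⟨s, hs, rfl⟩
    obtain ⟨i, j, rfl, hi, hi', hj, hj', -⟩ := (mem_smallExponents_two hu hv s).1 hs
    refine ⟨rfl, ?_⟩
    simp only [Multiset.insert_eq_cons, Multiset.map_cons, Multiset.map_singleton,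
        Multiset.mem_cons, Multiset.mem_singleton, forall_eq_or_imp, forall_eq]
    exact ⟨hmem i hi' hi, hmem j hj' hj⟩
  have h1 : (multisetsOf (gammaGens u v m \ {m}) 2 \
        Multiset.map (fun i => m + 2 ^ i - 1) '' smallExponents u v 1 2).Finite :=
    (finite_multisetsOf hfin 2).sdiff
  have h2 := (finite_smallExponents u v 1 3).image (Multiset.map fun i => m + 2 ^ i - 1)
  rw [minimalMultisets_eq hu hv hm]
  refine ⟨h1.union h2, ?_⟩
  rw [Set.ncard_union_eq _ h1 h2, Set.ncard_image_of_injective _ hinj,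
    Set.ncard_sdiff hsub ((finite_smallExponents u v 1 2).image _),
    Set.ncard_image_of_injective _ hinj, ncard_multisetsOf hfin,
    Set.ncard_sdiff_singleton_of_mem hA]
  rw [Set.disjoint_left]
  rintro s ⟨⟨hs, -⟩, -⟩ ⟨s', hs', rfl⟩
  obtain ⟨i, j, k, rfl, -⟩ := (mem_smallExponents_three hu hv s').1 hs'
  simp at hs

/-- The multiset of generators recorded by a formal combination of minimal generators. -/
noncomputable def generatorMultiset (Γ : AddSubmonoid ℕ) (f : minGens Γ →₀ ℕ) : Multiset ℕ :=
  (Finsupp.toMultiset f).map Subtype.val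

theorem sum_generatorMultiset (Γ : AddSubmonoid ℕ) (f : minGens Γ →₀ ℕ) :
    (generatorMultiset Γ f).sum = factorizationHom Γ f := by
  induction f using Finsupp.induction_linear with
  | zero => simp [generatorMultiset]
  | add f g hf hg =>
    rw [map_add, ← hf, ← hg]
    simp [generatorMultiset]
  | single a b => simp [generatorMultiset, factorizationHom, Multiset.map_nsmul,
      Multiset.sum_nsmul, mul_comm]

theorem injective_generatorMultiset (Γ : AddSubmonoid ℕ) :
    Function.Injective (generatorMultiset Γ) :=
  open Classical in
  (Multiset.map_injective Subtype.val_injective).comp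
    (Multiset.toFinsupp (α := minGens Γ)).symm.injective

theorem mem_generatorMultiset {Γ : AddSubmonoid ℕ} {f : minGens Γ →₀ ℕ} {x : ℕ} :
    x ∈ generatorMultiset Γ f ↔ ∃ h : x ∈ minGens Γ, f ⟨x, h⟩ ≠ 0 := by
  simp [generatorMultiset]

theorem exists_generatorMultiset_eq {Γ : AddSubmonoid ℕ} {s : Multiset ℕ}
    (hs : ∀ x ∈ s, x ∈ minGens Γ) : ∃ f, generatorMultiset Γ f = s := by
  lift s to Multiset (minGens Γ) using hs
  classical
  exact ⟨Multiset.toFinsupp s, by rw [generatorMultiset, Multiset.toFinsupp_toMultiset]⟩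

theorem exists_factorizationHom_eq (Γ : AddSubmonoid ℕ) :
    ∀ n ∈ Γ, ∃ f, factorizationHom Γ f = n := by
  intro n
  induction n using Nat.strong_induction_on with
  | _ n ih =>
  intro hn
  by_cases h0 : n = 0
  · exact ⟨0, by simp [h0]⟩
  by_cases hg : n ∈ minGens Γ
  · refine ⟨Finsupp.single ⟨n, hg⟩ 1, ?_⟩
    simp [factorizationHom]
  · have : ∃ a ∈ Γ, ∃ b ∈ Γ, a ≠ 0 ∧ b ≠ 0 ∧ n = a + b := by
      by_contra! hcon
      exact hg ⟨hn, h0, hcon⟩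
    obtain ⟨a, ha, b, hb, ha0, hb0, rfl⟩ := this
    obtain ⟨f, hf⟩ := ih a (by omega) ha
    obtain ⟨g, hg⟩ := ih b (by omega) hb
    exact ⟨f + g, by rw [map_add, hf, hg]⟩

theorem minGens_eq_gammaGens {u v m : ℕ} (hv : v ≤ u) (hm : 2 * 2 ^ u ≤ m)
    (Γ : AddSubmonoid ℕ)
    (hΓ : ∀ x, x ∈ Γ ↔ x = 0 ∨ (∃ i ≤ u, x + 1 = m + 2 ^ i) ∨ m + 2 ^ u + 2 ^ v ≤ x + 1) :
    minGens Γ = gammaGens u v m := by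
  have hM := two_pow_add_le hv hm
  have hone : ∀ i : ℕ, 1 ≤ 2 ^ i := fun i => Nat.one_le_two_pow
  have hu1 := hone u
  have hv1 := hone v
  have hge : ∀ x ∈ Γ, x ≠ 0 → m ≤ x := by
    intro x hx h0
    rcases (hΓ x).1 hx with h | ⟨i, -, h⟩ | h
    · exact absurd h h0
    · have := hone i
      omega
    · omega
  have hpow : ∀ i ≤ u, m + 2 ^ i - 1 ∈ Γ := fun i hi =>
    (hΓ _).2 (Or.inr (Or.inl ⟨i, hi, by have := hone i; omega⟩))
  ext x
  constructor
  · rintro ⟨hx, h0, h⟩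
    rcases (hΓ x).1 hx with h' | h' | h'
    · exact absurd h' h0
    · exact Or.inl h'
    · refine Or.inr ⟨h', ?_, ?_⟩
      · by_contra! hlt
        refine h m ?_ (x - m) ((hΓ _).2 (Or.inr (Or.inr ?_))) ?_ ?_ ?_
        · simpa using hpow 0 (Nat.zero_le u)
        all_goals omega
      · intro i hi j hj hij
        have := hone i
        have := hone j
        exact h _ (hpow i hi) _ (hpow j hj) (by omega) (by omega) (by omega)
  · intro hx
    have hmx := le_of_mem_gammaGens hx
    refine ⟨(hΓ x).2 (Or.inr (hx.imp_right fun h => h.1)), by omega, ?_⟩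
    rintro a ha b hb ha0 hb0 rfl
    have h1 := hge a ha ha0
    have h2 := hge b hb hb0
    have hlt := lt_of_mem_gammaGens hx
    have gen : ∀ y z, y ∈ Γ → y ≠ 0 → m ≤ z → y + z + 1 < 2 * m + 2 ^ u + 2 ^ v →
        y ∈ gammaGens u v m := by
      intro y z hy hy0 hz hyz
      rcases (hΓ y).1 hy with h | h | h
      · exact absurd h hy0
      · exact Or.inl h
      · omega
    exact ne_add_of_mem_gammaGens hm hx (gen a b ha ha0 h2 hlt)
      (gen b a hb hb0 h1 (by rwa [add_comm b])) rfl

theorem rho_eq_ncard_minimalMultisets {u v m : ℕ} (hu : 1 ≤ u) (hv : v ≤ u)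
    (hm : 2 * 2 ^ u ≤ m) (Γ : AddSubmonoid ℕ)
    (hΓ : ∀ x, x ∈ Γ ↔ x = 0 ∨ (∃ i ≤ u, x + 1 = m + 2 ^ i) ∨ m + 2 ^ u + 2 ^ v ≤ x + 1) :
    rho Γ = (minimalMultisets u v m).ncard := by
  have hgens := minGens_eq_gammaGens hv hm Γ hΓ
  have hM := two_pow_add_le hv hm
  have hu1 := Nat.one_le_two_pow (n := u)
  have hv1 := Nat.one_le_two_pow (n := v)
  have hmem : m ∈ minGens Γ := by
    rw [hgens]
    exact Or.inl ⟨0, Nat.zero_le _, by simp⟩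
  have hf : ∀ f, ∀ x ∈ generatorMultiset Γ f, x ∈ gammaGens u v m := fun f x hx => by
    rw [← hgens]
    exact (mem_generatorMultiset.1 hx).1
  have hsingle : ∀ i : minGens Γ, factorizationHom Γ (Finsupp.single i 1) = i := fun i => by
    simp [factorizationHom]
  have himage : generatorMultiset Γ '' (generatorMultiset Γ ⁻¹' minimalMultisets u v m) =
      minimalMultisets u v m := by
    rw [Set.image_preimage_eq_iff]
    intro s hs
    exact exists_generatorMultiset_eq (hgens ▸ hs.1)
  have hinj := injective_generatorMultiset Γ
  rw [← himage, Set.ncard_image_of_injective _ hinj]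
  refine sInf_ncard_addConGen_eq (factorizationHom Γ) ?_ ⟨m, hmem⟩
    (2 * m + 2 ^ u + 2 ^ v - 1) ?_ ?_ _ ?_
    ((ncard_minimalMultisets hu hv hm).1.preimage hinj.injOn)
  · intro i
    rw [hsingle]
    exact Nat.pos_of_ne_zero i.2.2.1
  · intro f f' h hlt
    rw [← sum_generatorMultiset, ← sum_generatorMultiset] at h
    rw [← sum_generatorMultiset] at hlt
    exact hinj (eq_of_sum_eq hv hm (hf f) (hf f') h (by omega))
  · intro n hn
    obtain ⟨f, h⟩ := exists_factorizationHom_eq Γ (n - m)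
      ((hΓ _).2 (Or.inr (Or.inr (by omega))))
    refine ⟨f, ?_⟩
    rw [map_add, h, hsingle]
    change n - m + m = n
    omega
  · intro f
    change (_ ∧ _ ∧ _ ∧ _) ↔ _
    rw [sum_generatorMultiset]
    constructor
    · rintro ⟨-, h1, h2, h3⟩
      refine ⟨?_, by omega, fun i hi => ?_⟩
      · by_contra h
        exact h1 (mem_generatorMultiset.2 ⟨hmem, h⟩)
      · have := h3 i (mem_generatorMultiset.2 ⟨i.2, hi⟩)
        rw [hsingle]
        omega
    · rintro ⟨h1, h2, h3⟩
      refine ⟨hf f, fun h => ?_, by omega, fun x hx => ?_⟩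
      · exact (mem_generatorMultiset.1 h).2 h1
      · obtain ⟨hx', hx0⟩ := mem_generatorMultiset.1 hx
        have := h3 ⟨x, hx'⟩ hx0
        rw [hsingle] at this
        simp only at this
        omega

/-- The number of minimal relations of Γ_m equals
C(e+1,2) - C(t,2) + q + C(t,3) + C(t-q,2), where e + 1 = m - C(t,2) + q. -/
theorem rho_gammaSet (t q m : ℕ) (ht : 2 ≤ t) (hq : q ≤ t - 2) (hm : 2 ^ t ≤ m)
    (Γ : AddSubmonoid ℕ) (hΓ : (Γ : Set ℕ) = GammaSet t q m) :
    rho Γ = Nat.choose (m - Nat.choose t 2 + q) 2 - Nat.choose t 2 + q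
      + Nat.choose t 3 + Nat.choose (t - q) 2 := by
  obtain ⟨v, hv⟩ : ∃ v, t = v + 1 + 1 + q := ⟨t - 2 - q, by omega⟩
  obtain ⟨u, rfl⟩ : ∃ u, t = u + 1 + 1 := ⟨t - 2, by omega⟩
  have hvu : v + 1 ≤ u + 1 := by omega
  have hm' : 2 * 2 ^ (u + 1) ≤ m := by rwa [pow_succ, mul_comm] at hm
  have hmem : ∀ x, x ∈ Γ ↔ x = 0 ∨ (∃ i ≤ u + 1, x + 1 = m + 2 ^ i) ∨
      m + 2 ^ (u + 1) + 2 ^ (v + 1) ≤ x + 1 := by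
    intro x
    rw [← SetLike.mem_coe, hΓ, GammaSet, Set.mem_union, Set.mem_union, or_assoc]
    have h1 : u + 1 + 1 - q - 1 = v + 1 := by omega
    refine or_congr Iff.rfl (or_congr (exists_congr fun i => and_congr_right fun _ => ?_) ?_)
    · have := Nat.one_le_two_pow (n := i)
      omega
    · rw [Set.mem_ofPred_eq, h1, Nat.add_sub_cancel]
      omega
  obtain ⟨hle, hcard⟩ := ncard_gammaGens hvu hm'
  rw [rho_eq_ncard_minimalMultisets (by omega) hvu hm' Γ hmem,
    (ncard_minimalMultisets (by omega) hvu hm').2, hcard]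
  simp only [ncard_smallExponents] at hle ⊢
  simp only [Nat.multichoose_eq, Nat.choose_one_right] at hle ⊢
  have e1 : u + 1 - 0 + (1 + 1) - 1 = u + 2 := by omega
  have e2 : v + 1 + 1 - 0 + 1 - 1 = v + 2 := by omega
  have e3 : u + 1 - 1 + (1 + 1) - 1 = u + 1 := by omega
  have e4 : v + 1 + 1 - 1 + 1 - 1 = v + 1 := by omega
  have e5 : u + 1 - 1 + (2 + 1) - 1 = u + 2 := by omega
  have e6 : v + 1 + 1 - 1 + 2 - 1 = v + 2 := by omega
  have e7 : u + 1 + 1 - q = v + 2 := by omega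
  rw [e1, e2] at hle
  rw [e1, e2, e3, e4, e5, e6, e7, show u + 1 + 1 = u + 2 from rfl]
  simp only [Nat.reduceAdd] at hle ⊢
  have e8 : u + 2 + (m - ((u + 2).choose 2 + (v + 2))) - 1 + 2 - 1 =
      m - (u + 2).choose 2 + q := by omega
  rw [e8]
  have e9 : (u + 2).choose 2 = (u + 1).choose 2 + (u + 1) := by
    rw [Nat.choose_succ_succ' (u + 1) 1, Nat.choose_one_right, add_comm]
  have e10 : (u + 2).choose 2 ≤ (m - (u + 2).choose 2 + q).choose 2 :=
    Nat.choose_le_choose 2 (by omega)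
  omega
end

section
/- Let t, q, m be integers with t ≥ 2, 0 ≤ q ≤ t−2, and m ≥ 2^t, and define the numerical monoid Γ_m = {0} ∪ {m + 2^i − 1 : 0 ≤ i ≤ t−1} ∪ {g ∈ ℕ : g ≥ m + 2^{t−1} + 2^{t−q−1} − 1} ⊆ ℕ. Write g_i = m + 2^i − 1 for 1 ≤ i ≤ t−1. Then the elements of Ap(Γ_m) that are positive and are not minimal generators of Γ_m are exactly the sums g_i + g_j with either 1 ≤ i ≤ j ≤ t−2, or j = t−1 and 1 ≤ i ≤ t−q−1; moreover these sums are pairwise distinct as the index pairs (i, j) with i ≤ j vary. -/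
open scoped Pointwise

lemma two_pow_add_two_pow_inj_s15 {i j i' j' : ℕ} (hij : i ≤ j) (hij' : i' ≤ j')
    (h : 2 ^ i + 2 ^ j = 2 ^ i' + 2 ^ j') : i = i' ∧ j = j' := by
  have hnot : ∀ {a b a' b' : ℕ}, a ≤ b → 2 ^ a + 2 ^ b = 2 ^ a' + 2 ^ b' → ¬ b < b' := by
    intro a b a' b' hab h hb
    have h1 : 2 ^ a ≤ 2 ^ b := Nat.pow_le_pow_right two_pos hab
    have h2 : 2 ^ (b + 1) ≤ 2 ^ b' := Nat.pow_le_pow_right two_pos hb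
    have h3 : 0 < 2 ^ a' := Nat.two_pow_pos a'
    rw [pow_succ] at h2
    omega
  have hj : j = j' := le_antisymm (Nat.le_of_not_lt (hnot hij' h.symm)) (Nat.le_of_not_lt (hnot hij h))
  subst hj
  exact ⟨Nat.pow_right_injective le_rfl (by simpa using h), rfl⟩

lemma mem_gammaSet_iff {t q m x : ℕ} :
    x ∈ GammaSet t q m ↔ x = 0 ∨ (∃ i ≤ t - 1, x = m + 2 ^ i - 1) ∨
      m + 2 ^ (t - 1) + 2 ^ (t - q - 1) - 1 ≤ x := by
  simp [GammaSet, or_assoc]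

lemma mult_gammaSet {t q m : ℕ} (hm : 0 < m) {Γ : AddSubmonoid ℕ}
    (hΓ : (Γ : Set ℕ) = GammaSet t q m) : mult Γ = m := by
  have mem : ∀ x, x ∈ Γ ↔ _ := fun x => by rw [← SetLike.mem_coe, hΓ, mem_gammaSet_iff]
  refine IsLeast.csInf_eq ⟨⟨(mem m).mpr (Or.inr (Or.inl ⟨0, by simp⟩)), hm.ne'⟩, ?_⟩
  rintro x ⟨hx, hx0⟩
  have hA := Nat.two_pow_pos (t - 1)
  have hB := Nat.two_pow_pos (t - q - 1)
  rcases (mem x).mp hx with h | ⟨i, -, h⟩ | h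
  · exact absurd h hx0
  · have := Nat.two_pow_pos i
    omega
  · omega

/-- The positive non-generator elements of the Apéry set of Γ_m are exactly the sums
g_i + g_j (with g_i = m + 2^i - 1) with 1 ≤ i ≤ j ≤ t-2, or j = t-1 and
1 ≤ i ≤ t-q-1; moreover these sums are pairwise distinct. -/
theorem apery_gammaSet (t q m : ℕ) (ht : 2 ≤ t) (hq : q ≤ t - 2) (hm : 2 ^ t ≤ m)
    (Γ : AddSubmonoid ℕ) (hΓ : (Γ : Set ℕ) = GammaSet t q m) :
    (∀ x : ℕ, (x ∈ aperySet Γ ∧ 0 < x ∧ x ∉ minGens Γ) ↔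
      ∃ i j : ℕ, 1 ≤ i ∧ i ≤ j ∧ (j ≤ t - 2 ∨ (j = t - 1 ∧ i ≤ t - q - 1)) ∧
        x = (m + 2 ^ i - 1) + (m + 2 ^ j - 1)) ∧
    (∀ i j i' j' : ℕ, 1 ≤ i → i ≤ j → (j ≤ t - 2 ∨ (j = t - 1 ∧ i ≤ t - q - 1)) →
      1 ≤ i' → i' ≤ j' → (j' ≤ t - 2 ∨ (j' = t - 1 ∧ i' ≤ t - q - 1)) →
      (m + 2 ^ i - 1) + (m + 2 ^ j - 1) = (m + 2 ^ i' - 1) + (m + 2 ^ j' - 1) →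
      i = i' ∧ j = j') := by
  have hm0 : 0 < m := lt_of_lt_of_le (Nat.two_pow_pos t) hm
  have mem : ∀ x, x ∈ Γ ↔ _ := fun x => by rw [← SetLike.mem_coe, hΓ, mem_gammaSet_iff]
  have hA := Nat.two_pow_pos (t - 1)
  have hB := Nat.two_pow_pos (t - q - 1)
  refine ⟨fun x => ⟨?_, ?_⟩, ?_⟩
  · rintro ⟨⟨hx, hap⟩, hx0, hgen⟩
    rw [mult_gammaSet hm0 hΓ] at hap
    have hsum : ∃ a ∈ Γ, ∃ b ∈ Γ, a ≠ 0 ∧ b ≠ 0 ∧ x = a + b := by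
      by_contra! hno
      exact hgen ⟨hx, hx0.ne', hno⟩
    obtain ⟨a, ha, b, hb, ha0, hb0, rfl⟩ := hsum
    have hlt : a + b < m + (m + 2 ^ (t - 1) + 2 ^ (t - q - 1) - 1) := by
      by_contra! hge
      exact hap ⟨a + b - m, (mem _).mpr (Or.inr (Or.inr (by omega))), by omega⟩
    have hform : ∀ {a b : ℕ}, a ∈ Γ → b ∈ Γ → a ≠ 0 → b ≠ 0 → (¬ ∃ γ ∈ Γ, a + b = γ + m) →
        a + b < m + (m + 2 ^ (t - 1) + 2 ^ (t - q - 1) - 1) →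
        ∃ i, 1 ≤ i ∧ i ≤ t - 1 ∧ a = m + 2 ^ i - 1 := by
      intro a b ha hb ha0 hb0 hap hlt
      have hbm : m ≤ b := by
        rw [← mult_gammaSet hm0 hΓ]
        exact Nat.sInf_le ⟨hb, hb0⟩
      rcases (mem a).mp ha with h | ⟨i, hi, h⟩ | h
      · exact absurd h ha0
      · refine ⟨i, Nat.one_le_iff_ne_zero.mpr ?_, hi, h⟩
        rintro rfl
        exact hap ⟨b, hb, by simp at h; omega⟩
      · omega
    obtain ⟨i, hi, hit, rfl⟩ := hform ha hb ha0 hb0 hap hlt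
    obtain ⟨j, hj, hjt, rfl⟩ := hform hb ha hb0 ha0 (by rwa [add_comm]) (by rwa [add_comm])
    have hle : ∀ {k l : ℕ}, l ≤ t - 1 →
        (m + 2 ^ k - 1) + (m + 2 ^ l - 1) < m + (m + 2 ^ (t - 1) + 2 ^ (t - q - 1) - 1) →
        l ≤ t - 2 ∨ (l = t - 1 ∧ k ≤ t - q - 1) := by
      intro k l hl hlt
      rcases Nat.lt_or_ge l (t - 1) with h | h
      · left
        omega
      · obtain rfl : l = t - 1 := le_antisymm hl h
        refine Or.inr ⟨rfl, ?_⟩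
        by_contra! hk
        have := Nat.pow_le_pow_right two_pos hk
        rw [Nat.succ_eq_add_one, pow_succ] at this
        omega
    rcases le_total i j with hij | hij
    · exact ⟨i, j, hi, hij, hle hjt hlt, rfl⟩
    · exact ⟨j, i, hj, hij, hle hit (by rwa [add_comm]), add_comm _ _⟩
  · rintro ⟨i, j, hi, hij, hj, rfl⟩
    have hgi : m + 2 ^ i - 1 ∈ Γ := (mem _).mpr (Or.inr (Or.inl ⟨i, by omega, rfl⟩))
    have hgj : m + 2 ^ j - 1 ∈ Γ := (mem _).mpr (Or.inr (Or.inl ⟨j, by omega, rfl⟩))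
    have hi2 : 2 ∣ 2 ^ i := dvd_pow_self 2 (by omega)
    have hj2 : 2 ∣ 2 ^ j := dvd_pow_self 2 (by omega)
    have hi0 := Nat.two_pow_pos i
    have hj0 := Nat.two_pow_pos j
    have hbound : 2 ^ i + 2 ^ j ≤ 2 ^ (t - 1) + 2 ^ (t - q - 1) := by
      rcases hj with h | ⟨rfl, h⟩
      · have h1 : 2 ^ i ≤ 2 ^ j := Nat.pow_le_pow_right two_pos hij
        have h2 : 2 ^ (j + 1) ≤ 2 ^ (t - 1) := Nat.pow_le_pow_right two_pos (by omega)
        rw [pow_succ] at h2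
        omega
      · have : 2 ^ i ≤ 2 ^ (t - q - 1) := Nat.pow_le_pow_right two_pos h
        omega
    refine ⟨⟨Γ.add_mem hgi hgj, ?_⟩, by omega, fun h => ?_⟩
    · rw [mult_gammaSet hm0 hΓ]
      rintro ⟨γ, hγ, h⟩
      rcases (mem γ).mp hγ with h0 | ⟨k, -, hk⟩ | hk
      · omega
      · rcases Nat.eq_zero_or_pos k with rfl | hk0
        · simp at hk
          omega
        · have hk2 : 2 ∣ 2 ^ k := dvd_pow_self 2 (by omega)
          have := Nat.two_pow_pos k
          omega
      · omega
    · exact h.2.2 _ hgi _ hgj (by omega) (by omega) rfl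
  · intro i j i' j' _ hij _ _ hij' _ h
    have := Nat.two_pow_pos i
    have := Nat.two_pow_pos j
    have := Nat.two_pow_pos i'
    have := Nat.two_pow_pos j'
    exact two_pow_add_two_pow_inj_s15 hij hij' (by omega)
end

section
/- For every integer e ≥ 3, let Γ be the additive submonoid of ℕ generated by the e+1 integers {e+2, e+3} ∪ {e+5, e+6, ..., 2e+3}. Then Γ is a numerical monoid with multiplicity e+2 and embedding dimension e+1 (the listed integers are its minimal generators), and ρ(Γ) = binom(e+1, 2). -/
open scoped Pointwise

open Finsupp

section RelationCount

variable {M ι : Type*} [AddCommMonoid M]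

/-- If every `F i` is related to an element outside the range of `F`, while no proper summand of
`F i` is related to another element, then generating the congruence takes at least as many pairs
as there are indices. -/
theorem card_le_ncard_of_addConGen_eq [Fintype ι] (c : AddCon M) (F : ι → M)
    (hF : Function.Injective F) (hout : ∀ i, ∃ b, c (F i) b ∧ b ∉ Set.range F)
    (hrigid : ∀ i a d b, F i = a + d → d ≠ 0 → c a b → a = b)
    (R : Set (M × M)) (hfin : R.Finite) (hR : addConGen (fun a b => (a, b) ∈ R) = c) :
    Fintype.card ι ≤ R.ncard := by
  classical
  let f : M → ι → ℚ := fun a i => if F i = a then 1 else 0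
  let D : M × M → ι → ℚ := fun p => f p.1 - f p.2
  let V : Submodule ℚ (ι → ℚ) := Submodule.span ℚ (D '' R)
  have hrel : ∀ a b, (a, b) ∈ R → c a b := fun a b h => by
    rw [← hR]; exact AddConGen.Rel.of a b h
  have hshift : ∀ a b d, c a b → d ≠ 0 → f (a + d) = f (b + d) := by
    intro a b d hab hd
    funext i
    have h1 : F i = a + d → F i = b + d := fun h => by
      rw [← hrigid i a d b h hd hab]; exact h
    have h2 : F i = b + d → F i = a + d := fun h => by
      rw [← hrigid i b d a h hd (c.symm hab)]; exact h
    simp only [f]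
    exact if_congr ⟨h1, h2⟩ rfl rfl
  have hshift' : ∀ a b d, c a b → f a - f b ∈ V → f (a + d) - f (b + d) ∈ V := by
    intro a b d hab hV
    by_cases hd : d = 0
    · simpa [hd] using hV
    · rw [hshift a b d hab hd, sub_self]; exact V.zero_mem
  let c' : AddCon M :=
    { r := fun a b => c a b ∧ f a - f b ∈ V
      iseqv :=
        { refl := fun a => ⟨c.refl a, by simp⟩
          symm := fun {a b} h => ⟨c.symm h.1, by simpa using V.neg_mem h.2⟩
          trans := fun {x y z} h h' => ⟨c.trans h.1 h'.1, by simpa using V.add_mem h.2 h'.2⟩ }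
      add' := fun {w x y z} h h' => ⟨c.add h.1 h'.1, by
        have h1 := hshift' w x y h.1 h.2
        have h2 := hshift' y z x h'.1 h'.2
        rw [add_comm y x, add_comm z x] at h2
        simpa using V.add_mem h1 h2⟩ }
  have hle : c ≤ c' := by
    rw [← hR]
    refine AddCon.addConGen_le.2 fun a b h => ?_
    exact ⟨hrel a b h, Submodule.subset_span ⟨(a, b), h, rfl⟩⟩
  have htop : V = ⊤ := by
    rw [eq_top_iff, ← (Pi.basisFun ℚ ι).span_eq, Submodule.span_le]
    rintro _ ⟨i, rfl⟩
    obtain ⟨b, hb, hbr⟩ := hout i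
    have h : f (F i) - f b ∈ V := (hle hb).2
    have heq : Pi.basisFun ℚ ι i = f (F i) - f b := by
      funext j
      have h1 : F j ≠ b := fun h => hbr ⟨j, h⟩
      simp [f, h1, hF.eq_iff, Pi.single_apply]
    rw [heq]
    exact h
  have hDfin : (D '' R).Finite := hfin.image D
  have : Fintype (D '' R) := hDfin.fintype
  calc Fintype.card ι = Module.finrank ℚ (ι → ℚ) := (Module.finrank_fintype_fun_eq_card ℚ).symm
    _ = Module.finrank ℚ V := by rw [htop, finrank_top]
    _ ≤ (D '' R).toFinset.card := finrank_span_le_card (D '' R)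
    _ = (D '' R).ncard := (Set.ncard_eq_toFinset_card' _).symm
    _ ≤ R.ncard := Set.ncard_image_le hfin

end RelationCount

namespace DeltaTwo

/-- The listed generators. -/
abbrev gens (e : ℕ) : Set ℕ := {e + 2, e + 3} ∪ {x | e + 5 ≤ x ∧ x ≤ 2 * e + 3}

theorem mem_gens {e x : ℕ} (he : 3 ≤ e) : x ∈ gens e ↔ e + 2 ≤ x ∧ x ≤ 2 * e + 3 ∧ x ≠ e + 4 := by
  simp only [gens, Set.mem_union, Set.mem_insert_iff, Set.mem_singleton_iff, Set.mem_ofPred_eq]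
  omega

theorem gens_eq_coe (e : ℕ) (he : 3 ≤ e) :
    gens e = ((Finset.Icc (e + 2) (2 * e + 3)).erase (e + 4) : Finset ℕ) := by
  ext x
  rw [mem_gens he]
  simp
  tauto

theorem ncard_gens (e : ℕ) (he : 3 ≤ e) : (gens e).ncard = e + 1 := by
  rw [gens_eq_coe e he, Set.ncard_coe_finset, Finset.card_erase_of_mem, Nat.card_Icc]
  · omega
  · rw [Finset.mem_Icc]; omega

theorem mem_closure_gens {e n : ℕ} (he : 3 ≤ e) :
    n ∈ AddSubmonoid.closure (gens e) ↔ n = 0 ∨ (e + 2 ≤ n ∧ n ≠ e + 4) := by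
  constructor
  · intro h
    induction h using AddSubmonoid.closure_induction with
    | mem x hx => rw [mem_gens he] at hx; omega
    | zero => exact Or.inl rfl
    | add x y _ _ hx hy => omega
  · induction n using Nat.strong_induction_on with
    | _ n ih =>
      intro h
      by_cases h0 : n = 0
      · rw [h0]; exact zero_mem _
      by_cases hn : n ≤ 2 * e + 3
      · exact AddSubmonoid.subset_closure ((mem_gens he).2 (by omega))
      by_cases hn' : n = 2 * e + 6
      · have hu : e + 3 ∈ AddSubmonoid.closure (gens e) :=
          AddSubmonoid.subset_closure ((mem_gens he).2 (by omega))
        have := add_mem hu hu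
        rwa [show e + 3 + (e + 3) = n by omega] at this
      · have hm : e + 2 ∈ AddSubmonoid.closure (gens e) :=
          AddSubmonoid.subset_closure ((mem_gens he).2 (by omega))
        have := add_mem hm (ih (n - (e + 2)) (by omega) (by omega))
        rwa [show e + 2 + (n - (e + 2)) = n by omega] at this

theorem isNumericalMonoid_closure_gens {e : ℕ} (he : 3 ≤ e) :
    IsNumericalMonoid (AddSubmonoid.closure (gens e)) := by
  refine (Set.finite_Iio (e + 5)).subset fun x hx => ?_
  rw [Set.mem_compl_iff, SetLike.mem_coe, mem_closure_gens he] at hx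
  rw [Set.mem_Iio]
  omega

theorem mult_closure_gens {e : ℕ} (he : 3 ≤ e) :
    mult (AddSubmonoid.closure (gens e)) = e + 2 := by
  refine IsLeast.csInf_eq ⟨⟨(mem_closure_gens he).2 (by omega), by omega⟩, ?_⟩
  rintro x ⟨hx, hx0⟩
  rw [mem_closure_gens he] at hx
  omega

theorem minGens_closure_gens {e : ℕ} (he : 3 ≤ e) :
    minGens (AddSubmonoid.closure (gens e)) = gens e := by
  ext x
  simp only [minGens, Set.mem_ofPred_eq, mem_closure_gens he, mem_gens he]
  constructor
  · rintro ⟨hx, hx0, h⟩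
    by_contra hcon
    by_cases hx' : x = 2 * e + 6
    · exact h (e + 3) (by omega) (e + 3) (by omega) (by omega) (by omega) (by omega)
    · exact h (e + 2) (by omega) (x - (e + 2)) (by omega) (by omega) (by omega) (by omega)
  · intro hx
    refine ⟨by omega, by omega, fun a ha b hb ha0 hb0 => by omega⟩

/-- The multiplicity, as a generator. -/
def mGen (e : ℕ) : gens e := ⟨e + 2, by simp⟩

/-- The second smallest generator. -/
def uGen (e : ℕ) : gens e := ⟨e + 3, by simp⟩

/-- The value of a formal combination of generators. -/
noncomputable def value (G : Set ℕ) : (G →₀ ℕ) →+ ℕ :=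
  Finsupp.liftAddHom fun g => AddMonoidHom.mulLeft (g : ℕ)

@[simp]
theorem value_single {G : Set ℕ} (g : G) (n : ℕ) : value G (single g n) = g * n := by
  simp [value]

theorem value_eq {e : ℕ} (he : 3 ≤ e) (a : gens e →₀ ℕ) :
    a = 0 ∨ (e + 2 ≤ value (gens e) a ∧ value (gens e) a ≠ e + 4) := by
  induction a using Finsupp.induction_linear with
  | zero => exact Or.inl rfl
  | add f g hf hg =>
    rcases hf with rfl | hf
    · simpa using hg
    rcases hg with rfl | hg
    · right; simpa using hf
    · right; rw [map_add]; omega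
  | single x n =>
    have hx := (mem_gens he).1 x.2
    rcases n with _ | _ | n
    · left; simp
    · right; simp; omega
    · right
      rw [value_single]
      have : (x : ℕ) * 2 ≤ x * (n + 1 + 1) := Nat.mul_le_mul_left _ (by omega)
      omega

/-- Combinations `k • m + w`, where `w` represents an element of the Apéry set. -/
inductive IsNormal (e : ℕ) : (gens e →₀ ℕ) → Prop
  | zero : IsNormal e 0
  | gen (x : gens e) (hx : x ≠ mGen e) : IsNormal e (single x 1)
  | double : IsNormal e (single (uGen e) 2)
  | step (a : gens e →₀ ℕ) (ha : IsNormal e a) : IsNormal e (a + single (mGen e) 1)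

theorem ne_mGen_iff {e : ℕ} {x : gens e} : x ≠ mGen e ↔ (x : ℕ) ≠ e + 2 := by
  rw [Ne, Subtype.ext_iff]; rfl

theorem ne_uGen_iff {e : ℕ} {x : gens e} : x ≠ uGen e ↔ (x : ℕ) ≠ e + 3 := by
  rw [Ne, Subtype.ext_iff]; rfl

@[simp] theorem coe_mGen (e : ℕ) : (mGen e : ℕ) = e + 2 := rfl

@[simp] theorem coe_uGen (e : ℕ) : (uGen e : ℕ) = e + 3 := rfl

theorem isNormal_single {e : ℕ} (x : gens e) : IsNormal e (single x 1) := by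
  by_cases hx : x = mGen e
  · subst hx
    simpa using IsNormal.step 0 (IsNormal.zero (e := e))
  · exact IsNormal.gen x hx

theorem value_eq_zero {e : ℕ} (he : 3 ≤ e) {a : gens e →₀ ℕ} (h : value (gens e) a = 0) :
    a = 0 := by
  rcases value_eq he a with h' | h'
  · exact h'
  · omega

theorem exists_single_add_eq {α : Type*} {a : α →₀ ℕ} (ha : a ≠ 0) :
    ∃ y b, single y 1 + b = a := by
  obtain ⟨y, hy⟩ := Finsupp.ne_iff.1 ha
  refine ⟨y, a - single y 1, add_tsub_cancel_of_le (Finsupp.single_le_iff.2 ?_)⟩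
  exact Nat.one_le_iff_ne_zero.2 hy

/-- A generator has only one factorization. -/
theorem eq_single_of_value {e : ℕ} (he : 3 ≤ e) (x : gens e) (a : gens e →₀ ℕ)
    (h : value (gens e) a = x) : a = single x 1 := by
  have hx := (mem_gens he).1 x.2
  have ha : a ≠ 0 := by rintro rfl; rw [map_zero] at h; omega
  obtain ⟨y, a', hsplit⟩ := exists_single_add_eq ha
  have hv := congrArg (value (gens e)) hsplit
  rw [map_add, value_single, h] at hv
  have hy' := (mem_gens he).1 y.2
  rcases value_eq he a' with h0 | h0
  · rw [h0] at hsplit hv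
    have : y = x := Subtype.ext (by simpa using hv)
    rw [← hsplit, this, add_zero]
  · omega

/-- The element `2 (e + 3)` has only one factorization. -/
theorem eq_double_of_value {e : ℕ} (he : 3 ≤ e) (a : gens e →₀ ℕ)
    (h : value (gens e) a = 2 * e + 6) : a = single (uGen e) 2 := by
  have ha : a ≠ 0 := by rintro rfl; rw [map_zero] at h; omega
  obtain ⟨y, a', hsplit⟩ := exists_single_add_eq ha
  have hv := congrArg (value (gens e)) hsplit
  rw [map_add, value_single, h] at hv
  have hy' := (mem_gens he).1 y.2
  rcases value_eq he a' with h0 | h0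
  · rw [h0, map_zero] at hv; omega
  · have hyu : y = uGen e := Subtype.ext (by rw [coe_uGen]; omega)
    have := eq_single_of_value he (uGen e) a' (by
      rw [hyu, coe_uGen] at hv
      rw [coe_uGen]
      omega)
    rw [← hsplit, this, hyu, ← Finsupp.single_add]

theorem IsNormal.eq_of_value {e : ℕ} (he : 3 ≤ e) {a b : gens e →₀ ℕ} (ha : IsNormal e a)
    (hb : IsNormal e b) (h : value (gens e) a = value (gens e) b) : a = b := by
  induction ha generalizing b with
  | zero => exact (value_eq_zero he (by rw [← h, map_zero])).symm
  | gen x hx => exact (eq_single_of_value he x b (by rw [← h]; simp)).symm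
  | double => exact (eq_double_of_value he b (by rw [← h]; simp; ring)).symm
  | step a ha ih =>
    cases hb with
    | zero => exact value_eq_zero he (by rw [h, map_zero])
    | gen x hx => exact eq_single_of_value he x _ (by rw [h]; simp)
    | double => exact eq_double_of_value he _ (by rw [h]; simp; ring)
    | step b hb =>
      rw [ih hb]
      simpa using h

theorem exists_isNormal {e : ℕ} (he : 3 ≤ e) (n : ℕ) (h : n = 0 ∨ (e + 2 ≤ n ∧ n ≠ e + 4)) :
    ∃ a, IsNormal e a ∧ value (gens e) a = n := by
  induction n using Nat.strong_induction_on with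
  | _ n ih =>
    by_cases h0 : n = 0
    · exact ⟨0, IsNormal.zero, by simp [h0]⟩
    by_cases hn : n ≤ 2 * e + 3
    · exact ⟨single ⟨n, (mem_gens he).2 (by omega)⟩ 1, isNormal_single _, by simp⟩
    by_cases hn' : n = 2 * e + 6
    · exact ⟨single (uGen e) 2, IsNormal.double, by simp; omega⟩
    · obtain ⟨a, ha, hv⟩ := ih (n - (e + 2)) (by omega) (by omega)
      exact ⟨_, IsNormal.step a ha, by simp [hv]; omega⟩

/-- Generators different from the multiplicity. -/
abbrev BigGen (e : ℕ) : Type := {x : gens e // x ≠ mGen e}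

/-- The second smallest generator, as a generator different from the multiplicity. -/
def uBig (e : ℕ) : BigGen e := ⟨uGen e, by rw [ne_mGen_iff]; simp⟩

/-- The sum of an unordered pair of generators. -/
noncomputable def pairSum (e : ℕ) : Sym2 (BigGen e) → (gens e →₀ ℕ) :=
  Sym2.lift ⟨fun x y => single x.1 1 + single y.1 1, fun _ _ => add_comm _ _⟩

open Classical in
/-- The factorizations not connected to any factorization involving the multiplicity, indexed by
unordered pairs: the pair of twice the second smallest generator, whose value lies in the Apéry
set, is replaced by the triple. -/
noncomputable def isolated (e : ℕ) (p : Sym2 (BigGen e)) : gens e →₀ ℕ :=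
  if p = s(uBig e, uBig e) then single (uGen e) 3 else pairSum e p

theorem isolated_diag (e : ℕ) : isolated e s(uBig e, uBig e) = single (uGen e) 3 := if_pos rfl

theorem isolated_of_ne {e : ℕ} {x y : BigGen e} (h : x ≠ uBig e ∨ y ≠ uBig e) :
    isolated e s(x, y) = single x.1 1 + single y.1 1 := by
  refine if_neg fun hp => ?_
  rcases Sym2.eq_iff.1 hp with ⟨rfl, rfl⟩ | ⟨rfl, rfl⟩ <;> simp at h

theorem isolated_cases {e : ℕ} (p : Sym2 (BigGen e)) :
    isolated e p = single (uGen e) 3 ∨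
      ∃ x y : gens e, x ≠ mGen e ∧ y ≠ mGen e ∧ (x ≠ uGen e ∨ y ≠ uGen e) ∧
        isolated e p = single x 1 + single y 1 := by
  induction p using Sym2.ind with
  | _ x y =>
    by_cases h : x = uBig e ∧ y = uBig e
    · left; rw [h.1, h.2, isolated_diag]
    · have h' : x ≠ uBig e ∨ y ≠ uBig e := by tauto
      refine Or.inr ⟨x.1, y.1, x.2, y.2, ?_, isolated_of_ne h'⟩
      exact h'.imp (fun h hx => h (Subtype.ext hx)) (fun h hy => h (Subtype.ext hy))

theorem pairSum_injective (e : ℕ) : Function.Injective (pairSum e) := by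
  intro p q
  induction p using Sym2.ind with
  | _ x y =>
    induction q using Sym2.ind with
    | _ z w =>
      intro h
      simp only [pairSum, Sym2.lift_mk] at h
      rw [Finsupp.single_add_single_eq_single_add_single one_ne_zero one_ne_zero] at h
      simp only [Subtype.ext_iff, Sym2.eq_iff]
      simp [Subtype.ext_iff] at h
      tauto

theorem degree_pairSum (e : ℕ) (p : Sym2 (BigGen e)) : (pairSum e p).degree = 2 := by
  induction p using Sym2.ind with
  | _ x y => simp [pairSum]

theorem isolated_injective (e : ℕ) : Function.Injective (isolated e) := by
  intro p q h
  have hdeg : ∀ p, single (uGen e) 3 ≠ pairSum e p := fun p hp => by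
    have := congrArg Finsupp.degree hp
    rw [degree_pairSum] at this
    simp at this
  unfold isolated at h
  split_ifs at h with hp hq hq
  · rw [hp, hq]
  · exact (hdeg _ h).elim
  · exact (hdeg _ h.symm).elim
  · exact pairSum_injective e h

theorem IsNormal.ne_isolated {e : ℕ} {a : gens e →₀ ℕ} (ha : IsNormal e a)
    (p : Sym2 (BigGen e)) : isolated e p ≠ a := by
  have hdeg : 2 ≤ (isolated e p).degree := by
    rcases isolated_cases p with h | ⟨x, y, -, -, -, h⟩ <;> rw [h] <;> simp
  have hm : isolated e p (mGen e) = 0 := by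
    rcases isolated_cases p with h | ⟨x, y, hx, hy, -, h⟩ <;> rw [h]
    · exact Finsupp.single_eq_of_ne (uBig e).2.symm
    · simp [Finsupp.single_eq_of_ne hx.symm, Finsupp.single_eq_of_ne hy.symm]
  rintro rfl
  generalize hq : isolated e p = q at *
  cases ha with
  | zero => simp at hdeg
  | gen x hx => simp at hdeg
  | double =>
    rcases isolated_cases p with h | ⟨x, y, -, -, hxy, h⟩ <;> rw [hq] at h
    · simpa using congrArg Finsupp.degree h
    · have hu := DFunLike.congr_fun h (uGen e)
      rw [Finsupp.add_apply, Finsupp.single_eq_same] at hu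
      have hle : ∀ z : gens e, single z 1 (uGen e) ≤ 1 := fun z => by
        rw [Finsupp.single_apply]; split_ifs <;> omega
      have hlex := hle x
      have hley := hle y
      rcases hxy with hx | hy
      · rw [Finsupp.single_eq_of_ne hx.symm] at hu; omega
      · rw [Finsupp.single_eq_of_ne hy.symm] at hu; omega
  | step a ha => simp at hm

theorem exists_isNormal_isolated {e : ℕ} (he : 3 ≤ e) (p : Sym2 (BigGen e)) :
    ∃ a, IsNormal e a ∧ value (gens e) (isolated e p) = value (gens e) a := by
  obtain ⟨a, ha, hv⟩ := exists_isNormal he (value (gens e) (isolated e p)) (by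
    rcases value_eq he (isolated e p) with h | h
    · left; rw [h, map_zero]
    · exact Or.inr h)
  exact ⟨a, ha, hv.symm⟩

/-- Every proper summand of an isolated factorization is the only factorization of its value. -/
theorem isolated_rigid {e : ℕ} (he : 3 ≤ e) (p : Sym2 (BigGen e)) (a d b : gens e →₀ ℕ)
    (h : isolated e p = a + d) (hd : d ≠ 0)
    (hab : value (gens e) a = value (gens e) b) : a = b := by
  rcases isolated_cases p with hp | ⟨x, y, -, -, -, hp⟩ <;> rw [hp] at h
  · have hz : ∀ z, z ≠ uGen e → a z = 0 ∧ d z = 0 := fun z hz => by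
      have := DFunLike.congr_fun h z
      rw [Finsupp.single_eq_of_ne hz, Finsupp.add_apply] at this
      omega
    have ha : a = single (uGen e) (a (uGen e)) := by
      ext z
      by_cases hzu : z = uGen e
      · rw [hzu, Finsupp.single_eq_same]
      · rw [Finsupp.single_eq_of_ne hzu, (hz z hzu).1]
    have hdu : d (uGen e) ≠ 0 := fun hdu => hd (by
      ext z
      by_cases hzu : z = uGen e
      · rw [hzu, hdu]; rfl
      · rw [(hz z hzu).2]; rfl)
    have hu := DFunLike.congr_fun h (uGen e)
    rw [Finsupp.single_eq_same, Finsupp.add_apply] at hu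
    obtain h0 | h1 | h2 : a (uGen e) = 0 ∨ a (uGen e) = 1 ∨ a (uGen e) = 2 := by omega
    · rw [h0, Finsupp.single_zero] at ha
      rw [ha, map_zero] at hab
      rw [ha, value_eq_zero he hab.symm]
    · rw [h1] at ha
      rw [ha, value_single, mul_one] at hab
      rw [ha, eq_single_of_value he _ b hab.symm]
    · rw [h2] at ha
      rw [ha, value_single, coe_uGen] at hab
      rw [ha, eq_double_of_value he b (by omega)]
  · have hdeg := congrArg Finsupp.degree h
    simp only [map_add, Finsupp.degree_single] at hdeg
    have hd' : d.degree ≠ 0 := fun h0 => hd ((Finsupp.degree_eq_zero_iff d).1 h0)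
    obtain h0 | h1 : a.degree = 0 ∨ a.degree = 1 := by omega
    · have ha := (Finsupp.degree_eq_zero_iff a).1 h0
      rw [ha, map_zero] at hab
      rw [ha, value_eq_zero he hab.symm]
    · obtain ⟨z, a', rfl⟩ := exists_single_add_eq (a := a) (by rintro rfl; simp at h1)
      have ha' : a' = 0 := (Finsupp.degree_eq_zero_iff a').1 (by simpa using h1)
      rw [ha', add_zero] at hab ⊢
      rw [value_single, mul_one] at hab
      exact (eq_single_of_value he z b hab.symm).symm

section Reduction

variable {e : ℕ} {c : AddCon (gens e →₀ ℕ)}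

theorem exists_isNormal_single_add_single
    (hred : ∀ p, ∃ b, IsNormal e b ∧ c (isolated e p) b) (x y : gens e) :
    ∃ b, IsNormal e b ∧ c (single x 1 + single y 1) b := by
  by_cases hy : y = mGen e
  · subst hy
    exact ⟨_, IsNormal.step _ (isNormal_single x), c.refl _⟩
  by_cases hx : x = mGen e
  · subst hx
    exact ⟨_, IsNormal.step _ (isNormal_single y), by rw [add_comm]; exact c.refl _⟩
  by_cases hxy : x = uGen e ∧ y = uGen e
  · obtain ⟨rfl, rfl⟩ := hxy
    exact ⟨_, IsNormal.double, by rw [← Finsupp.single_add]; exact c.refl _⟩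
  · obtain ⟨b, hb, hcb⟩ := hred s(⟨x, hx⟩, ⟨y, hy⟩)
    rw [isolated_of_ne (by simp only [uBig, Ne, Subtype.mk.injEq]; tauto)] at hcb
    exact ⟨b, hb, hcb⟩

theorem exists_isNormal_double_add_single (he : 3 ≤ e)
    (hval : ∀ a b, c a b → value (gens e) a = value (gens e) b)
    (hred : ∀ p, ∃ b, IsNormal e b ∧ c (isolated e p) b) (x : gens e) :
    ∃ b, IsNormal e b ∧ c (single (uGen e) 2 + single x 1) b := by
  by_cases hxm : x = mGen e
  · subst hxm
    exact ⟨_, IsNormal.step _ IsNormal.double, c.refl _⟩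
  by_cases hxu : x = uGen e
  · subst hxu
    obtain ⟨b, hb, hcb⟩ := hred s(uBig e, uBig e)
    rw [isolated_diag] at hcb
    exact ⟨b, hb, by rwa [← Finsupp.single_add]⟩
  have hx := (mem_gens he).1 x.2
  rw [← Ne, ne_mGen_iff] at hxm
  rw [← Ne, ne_uGen_iff] at hxu
  obtain ⟨r, hr, hcr⟩ := exists_isNormal_single_add_single hred (uGen e) x
  have hrv := hval _ _ hcr
  simp only [map_add, value_single, coe_uGen, mul_one] at hrv
  have hsum : c (single (uGen e) 2 + single x 1) (single (uGen e) 1 + r) := by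
    have := c.add (c.refl (single (uGen e) 1)) hcr
    rwa [← add_assoc, ← Finsupp.single_add] at this
  by_cases hx' : (x : ℕ) = 2 * e + 3
  · have h3 := IsNormal.step _ (IsNormal.step _ (isNormal_single (mGen e)))
    have hr3 := hr.eq_of_value he h3 (by simp [← hrv]; omega)
    refine ⟨_, IsNormal.step _ (IsNormal.step _ (IsNormal.step _ (isNormal_single (uGen e)))), ?_⟩
    rw [hr3, ← add_assoc, ← add_assoc] at hsum
    exact hsum
  · let y : gens e := ⟨x + 1, (mem_gens he).2 (by omega)⟩
    have hr2 := hr.eq_of_value he (IsNormal.step _ (isNormal_single y)) (by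
      simp [← hrv, y]; omega)
    obtain ⟨b, hb, hcb⟩ := exists_isNormal_single_add_single hred (uGen e) y
    refine ⟨_, IsNormal.step _ hb, c.trans hsum ?_⟩
    rw [hr2, ← add_assoc]
    exact c.add hcb (c.refl _)

theorem IsNormal.exists_add_single (he : 3 ≤ e)
    (hval : ∀ a b, c a b → value (gens e) a = value (gens e) b)
    (hred : ∀ p, ∃ b, IsNormal e b ∧ c (isolated e p) b) {a : gens e →₀ ℕ}
    (ha : IsNormal e a) (x : gens e) : ∃ b, IsNormal e b ∧ c (a + single x 1) b := by
  induction ha with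
  | zero => exact ⟨_, isNormal_single x, by rw [zero_add]; exact c.refl _⟩
  | gen y hy => exact exists_isNormal_single_add_single hred y x
  | double => exact exists_isNormal_double_add_single he hval hred x
  | step a ha ih =>
    obtain ⟨b, hb, hcb⟩ := ih
    refine ⟨_, IsNormal.step b hb, ?_⟩
    rw [add_right_comm]
    exact c.add hcb (c.refl _)

theorem exists_isNormal_rel (he : 3 ≤ e)
    (hval : ∀ a b, c a b → value (gens e) a = value (gens e) b)
    (hred : ∀ p, ∃ b, IsNormal e b ∧ c (isolated e p) b) (a : gens e →₀ ℕ) :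
    ∃ b, IsNormal e b ∧ c a b := by
  have key : ∀ g, (∃ b, IsNormal e b ∧ c g b) → ∃ b, IsNormal e b ∧ c (g + a) b := by
    induction a using Finsupp.induction_linear with
    | zero => simp
    | add f f' hf hf' =>
      intro g hg
      rw [← add_assoc]
      exact hf' _ (hf _ hg)
    | single x n =>
      intro g hg
      induction n with
      | zero => simpa using hg
      | succ n ih =>
        obtain ⟨b, hb, hcb⟩ := ih
        obtain ⟨b', hb', hcb'⟩ := hb.exists_add_single he hval hred x
        refine ⟨b', hb', c.trans ?_ hcb'⟩
        rw [Finsupp.single_add, ← add_assoc]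
        exact c.add hcb (c.refl _)
  simpa using key 0 ⟨0, IsNormal.zero, c.refl _⟩

end Reduction

/-- The least number of pairs generating the congruence of equal values. -/
noncomputable def relationCount (G : Set ℕ) : ℕ :=
  sInf {n : ℕ | ∃ R : Set ((G →₀ ℕ) × (G →₀ ℕ)),
    R.Finite ∧ R.ncard = n ∧ addConGen (fun a b => (a, b) ∈ R) = AddCon.ker (value G)}

theorem finite_gens {e : ℕ} (he : 3 ≤ e) : (gens e).Finite := by
  rw [gens_eq_coe e he]; exact Finset.finite_toSet _

theorem card_bigGen {e : ℕ} (he : 3 ≤ e) [Fintype (BigGen e)] : Fintype.card (BigGen e) = e := by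
  classical
  have := (finite_gens he).fintype
  have h1 : Fintype.card (gens e) = e + 1 := by
    rw [← Nat.card_eq_fintype_card, Nat.card_coe_set_eq, ncard_gens e he]
  have h2 := Set.card_ne_eq (mGen e)
  rw [h1] at h2
  rw [← Nat.card_eq_fintype_card] at h2 ⊢
  exact h2

theorem relationCount_gens {e : ℕ} (he : 3 ≤ e) :
    relationCount (gens e) = Nat.choose (e + 1) 2 := by
  classical
  have := (finite_gens he).fintype
  have hcard : Fintype.card (Sym2 (BigGen e)) = Nat.choose (e + 1) 2 := by
    rw [Sym2.card, card_bigGen he]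
  choose r hr hrv using exists_isNormal_isolated he
  have hinj : Function.Injective fun p => (isolated e p, r p) := fun p q h =>
    isolated_injective e (congrArg Prod.fst h)
  refine IsLeast.csInf_eq ⟨⟨Set.range fun p => (isolated e p, r p), Set.finite_range _, ?_, ?_⟩, ?_⟩
  · rw [← hcard, ← Set.image_univ, Set.ncard_image_of_injective _ hinj, Set.ncard_univ,
      Nat.card_eq_fintype_card]
  · set c := addConGen fun a b => (a, b) ∈ Set.range fun p => (isolated e p, r p) with hc
    have hle : c ≤ AddCon.ker (value (gens e)) := by
      refine AddCon.addConGen_le.2 ?_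
      rintro a b ⟨p, hp⟩
      obtain ⟨rfl, rfl⟩ := Prod.mk.inj hp
      exact hrv p
    refine le_antisymm hle fun a b hab => ?_
    have hval : ∀ a b, c a b → value (gens e) a = value (gens e) b := fun a b h => hle h
    have hred : ∀ p, ∃ b, IsNormal e b ∧ c (isolated e p) b := fun p =>
      ⟨r p, hr p, AddConGen.Rel.of _ _ ⟨p, rfl⟩⟩
    obtain ⟨a', ha', hca⟩ := exists_isNormal_rel he hval hred a
    obtain ⟨b', hb', hcb⟩ := exists_isNormal_rel he hval hred b
    have : a' = b' := ha'.eq_of_value he hb' (by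
      rw [← hval _ _ hca, ← hval _ _ hcb]; exact hab)
    subst this
    exact c.trans hca (c.symm hcb)
  · rintro _ ⟨R, hfin, rfl, hR⟩
    rw [← hcard]
    refine card_le_ncard_of_addConGen_eq _ (isolated e) (isolated_injective e) (fun p => ?_)
      (fun p a d b h hd hab => isolated_rigid he p a d b h hd hab) R hfin hR
    exact ⟨r p, hrv p, fun ⟨q, hq⟩ => (hr p).ne_isolated q hq⟩

end DeltaTwo

/-- The monoid ⟨e+2, e+3, e+5, …, 2e+3⟩ is a numerical monoid with multiplicity e+2,
minimal generators as listed, embedding dimension e+1, and ρ = C(e+1,2). -/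
theorem rho_example_delta2 (e : ℕ) (he : 3 ≤ e) :
    IsNumericalMonoid
        (AddSubmonoid.closure ({e + 2, e + 3} ∪ {x | e + 5 ≤ x ∧ x ≤ 2 * e + 3})) ∧
    mult (AddSubmonoid.closure ({e + 2, e + 3} ∪ {x | e + 5 ≤ x ∧ x ≤ 2 * e + 3})) = e + 2 ∧
    minGens (AddSubmonoid.closure ({e + 2, e + 3} ∪ {x | e + 5 ≤ x ∧ x ≤ 2 * e + 3})) =
      ({e + 2, e + 3} ∪ {x | e + 5 ≤ x ∧ x ≤ 2 * e + 3}) ∧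
    edim (AddSubmonoid.closure ({e + 2, e + 3} ∪ {x | e + 5 ≤ x ∧ x ≤ 2 * e + 3})) = e + 1 ∧
    rho (AddSubmonoid.closure ({e + 2, e + 3} ∪ {x | e + 5 ≤ x ∧ x ≤ 2 * e + 3})) =
      Nat.choose (e + 1) 2 := by
  exact ⟨DeltaTwo.isNumericalMonoid_closure_gens he, DeltaTwo.mult_closure_gens he,
    DeltaTwo.minGens_closure_gens he,
    (congrArg Set.ncard (DeltaTwo.minGens_closure_gens he)).trans (DeltaTwo.ncard_gens e he),
    (congrArg DeltaTwo.relationCount (DeltaTwo.minGens_closure_gens he)).trans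
      (DeltaTwo.relationCount_gens he)⟩
end

section
/- For every integer e ≥ 3, let Γ be the additive submonoid of ℕ generated by the e+1 integers {e+4, e+5, e+7, 2e+13} ∪ {2e+15, 2e+16, ..., 3e+11}. Then Γ is a numerical monoid with multiplicity e+4 and embedding dimension e+1 (the listed integers are its minimal generators), and ρ(Γ) = binom(e+1, 2) + 1. -/
open scoped Pointwise

/-- A factorization is unique when no other formal combination has the same value. -/
def IsUniqueFactorization (Γ : AddSubmonoid ℕ) (x : minGens Γ →₀ ℕ) : Prop :=
  ∀ y, factorizationHom Γ y = factorizationHom Γ x → y = x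

section General

variable {Γ : AddSubmonoid ℕ}

@[simp]
lemma factorizationHom_single (g : minGens Γ) (n : ℕ) :
    factorizationHom Γ (Finsupp.single g n) = g * n := by
  simp [factorizationHom]

lemma minGens_pos (g : minGens Γ) : 0 < (g : ℕ) := Nat.pos_of_ne_zero g.2.2.1

lemma exists_eq_single_add {α : Type*} {x : α →₀ ℕ} {g : α} (h : x g ≠ 0) :
    ∃ y, x = Finsupp.single g 1 + y := by
  classical
  have hle : Finsupp.single g 1 ≤ x := by
    intro i
    rw [Finsupp.single_apply]
    split_ifs with hi
    · subst hi; omega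
    · exact Nat.zero_le _
  exact ⟨x - Finsupp.single g 1, (add_tsub_cancel_of_le hle).symm⟩

lemma exists_eq_single_add_of_ne_zero {α : Type*} {x : α →₀ ℕ} (h : x ≠ 0) :
    ∃ g y, x = Finsupp.single g 1 + y := by
  obtain ⟨g, hg⟩ := Finsupp.ne_iff.1 h
  exact ⟨g, exists_eq_single_add hg⟩

lemma factorizationHom_eq_zero {x : minGens Γ →₀ ℕ} (h : factorizationHom Γ x = 0) : x = 0 := by
  by_contra hx
  obtain ⟨g, y, rfl⟩ := exists_eq_single_add_of_ne_zero hx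
  have := minGens_pos g
  simp at h
  omega

lemma factorizationHom_mem (x : minGens Γ →₀ ℕ) : factorizationHom Γ x ∈ Γ := by
  induction x using Finsupp.induction_linear with
  | zero => simp
  | add x y hx hy => rw [map_add]; exact Γ.add_mem hx hy
  | single g n =>
    rw [factorizationHom_single, mul_comm]
    exact Γ.nsmul_mem g.2.1 n

lemma exists_factorization (h : AddSubmonoid.closure (minGens Γ) = Γ) {n : ℕ} (hn : n ∈ Γ) :
    ∃ x, factorizationHom Γ x = n := by
  have : AddSubmonoid.closure (minGens Γ) ≤ AddMonoidHom.mrange (factorizationHom Γ) := by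
    rw [AddSubmonoid.closure_le]
    intro g hg
    exact ⟨Finsupp.single ⟨g, hg⟩ 1, by simp⟩
  rw [← h] at hn
  exact this hn

lemma isUniqueFactorization_zero : IsUniqueFactorization Γ 0 := fun y hy =>
  factorizationHom_eq_zero (by simpa using hy)

lemma isUniqueFactorization_single (g : minGens Γ) :
    IsUniqueFactorization Γ (Finsupp.single g 1) := by
  intro y hy
  rw [factorizationHom_single, mul_one] at hy
  have hy0 : y ≠ 0 := by
    rintro rfl
    have := minGens_pos g
    simp at hy
    omega
  obtain ⟨k, z, rfl⟩ := exists_eq_single_add_of_ne_zero hy0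
  rw [map_add, factorizationHom_single, mul_one] at hy
  by_cases hz : z = 0
  · subst hz
    have : k = g := Subtype.ext (by simpa using hy)
    simp [this]
  · exact absurd hy.symm (g.2.2.2 _ k.2.1 _ (factorizationHom_mem z) k.2.2.1
      fun h => hz (factorizationHom_eq_zero h))

/-- A sum of two generators is a unique factorization when removing any generator from its value
leaves the other summand or leaves the monoid. -/
lemma isUniqueFactorization_single_add_single (p q : minGens Γ)
    (h : ∀ g : minGens Γ, ∀ n ∈ Γ, (g : ℕ) + n = p + q → g = p ∨ g = q) :
    IsUniqueFactorization Γ (Finsupp.single p 1 + Finsupp.single q 1) := by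
  intro y hy
  simp only [map_add, factorizationHom_single, mul_one] at hy
  have hy0 : y ≠ 0 := by
    rintro rfl
    have := minGens_pos p
    simp at hy
    omega
  obtain ⟨g, z, rfl⟩ := exists_eq_single_add_of_ne_zero hy0
  rw [map_add, factorizationHom_single, mul_one] at hy
  rcases h g _ (factorizationHom_mem z) hy with rfl | rfl
  · rw [isUniqueFactorization_single q z (by simp; omega)]
  · rw [isUniqueFactorization_single p z (by simp; omega), add_comm]

lemma eq_or_eq_of_add_single_eq {α : Type*} {p q g : α} {x : α →₀ ℕ}
    (h : x + Finsupp.single g 1 = Finsupp.single p 1 + Finsupp.single q 1) :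
    x = Finsupp.single p 1 ∨ x = Finsupp.single q 1 := by
  classical
  have hg := DFunLike.congr_fun h g
  simp only [Finsupp.add_apply, Finsupp.single_eq_same, Finsupp.single_apply] at hg
  by_cases hp : p = g
  · subst hp
    right
    rw [add_comm] at h
    exact add_left_cancel h
  · by_cases hq : q = g
    · subst hq
      left
      exact add_right_cancel h
    · simp [hp, hq] at hg

/-- If `S` is a set of factorizations avoiding a generator `a`, each of value attained by a
factorization involving `a`, such that `S` generates the ideal of non-unique factorizations avoiding
`a`, and all proper divisors of elements of `S` are unique factorizations, then the number of
minimal relations is the cardinality of `S`. -/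
theorem rho_eq_card (S : Finset (minGens Γ →₀ ℕ)) (a : minGens Γ)
    (hgen : ∀ x : minGens Γ →₀ ℕ, x a = 0 →
      IsUniqueFactorization Γ x ∨ ∃ s ∈ S, ∃ y, x = s + y)
    (hdiv : ∀ s ∈ S, ∀ g x, x + Finsupp.single g 1 = s → IsUniqueFactorization Γ x)
    (ha : ∀ s ∈ S, s a = 0)
    (hval : ∀ s ∈ S, ∃ t, factorizationHom Γ t = factorizationHom Γ s ∧ t a ≠ 0) :
    rho Γ = S.card := by
  classical
  have hval' : ∀ s : minGens Γ →₀ ℕ, ∃ t, s ∈ S →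
      factorizationHom Γ t = factorizationHom Γ s ∧ t a ≠ 0 := by
    intro s
    by_cases hs : s ∈ S
    · obtain ⟨t, ht⟩ := hval s hs
      exact ⟨t, fun _ => ht⟩
    · exact ⟨0, fun h => absurd h hs⟩
  choose t ht using hval'
  have hmem : S.card ∈ {n : ℕ | ∃ R : Set ((minGens Γ →₀ ℕ) × (minGens Γ →₀ ℕ)),
      R.Finite ∧ R.ncard = n ∧
      addConGen (fun a b => (a, b) ∈ R) = AddCon.ker (factorizationHom Γ)} := by
    refine ⟨(S.image fun s => (s, t s) : Finset _), Finset.finite_toSet _, ?_, ?_⟩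
    · rw [Set.ncard_coe_finset]
      exact Finset.card_image_of_injective _ fun x y h => (Prod.ext_iff.1 h).1
    · set C := addConGen (fun x y => (x, y) ∈
        ((S.image fun s => (s, t s) : Finset _) : Set ((minGens Γ →₀ ℕ) × (minGens Γ →₀ ℕ))))
        with hC
      have hCS : ∀ s ∈ S, C s (t s) := fun s hs =>
        AddConGen.Rel.of _ _ (Finset.mem_coe.2 (Finset.mem_image_of_mem _ hs))
      apply le_antisymm
      · rw [hC, AddCon.addConGen_le]
        intro x y hxy
        obtain ⟨s, hs, h⟩ := Finset.mem_image.1 (Finset.mem_coe.1 hxy)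
        obtain ⟨rfl, rfl⟩ := Prod.ext_iff.1 h
        exact ((ht _ hs).1).symm
      · have hraise : ∀ x, IsUniqueFactorization Γ x ∨ ∃ y,
            C x (Finsupp.single a 1 + y) ∧
              factorizationHom Γ (Finsupp.single a 1 + y) = factorizationHom Γ x := by
          intro x
          by_cases hx : x a = 0
          · refine (hgen x hx).imp_right ?_
            rintro ⟨s, hs, z, rfl⟩
            obtain ⟨y, hy⟩ := exists_eq_single_add (ht s hs).2
            refine ⟨y + z, ?_, ?_⟩
            · rw [← add_assoc, ← hy]
              exact C.add (hCS s hs) (C.refl z)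
            · rw [← add_assoc, ← hy, map_add, map_add, (ht s hs).1]
          · right
            obtain ⟨y, hy⟩ := exists_eq_single_add hx
            exact ⟨y, hy ▸ C.refl _, hy ▸ rfl⟩
        have hmain : ∀ n, ∀ x y, factorizationHom Γ x = n → factorizationHom Γ y = n →
            C x y := by
          intro n
          induction n using Nat.strong_induction_on with
          | _ n ih =>
            intro x y hx hy
            rcases hraise x with hu | ⟨x', hxx', hx'⟩
            · rw [hu y (hy.trans hx.symm)]
              exact C.refl x
            rcases hraise y with hu | ⟨y', hyy', hy'⟩
            · rw [hu x (hx.trans hy.symm)]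
              exact C.refl y
            refine C.trans hxx' (C.trans ?_ (C.symm hyy'))
            have hpos := minGens_pos a
            rw [map_add, factorizationHom_single, mul_one] at hx' hy'
            exact C.add (C.refl _) (ih (factorizationHom Γ x') (by omega) _ _ rfl (by omega))
        intro x y hxy
        exact hmain _ x y rfl (Eq.symm hxy)
  apply le_antisymm (Nat.sInf_le hmem)
  apply le_csInf ⟨_, hmem⟩
  rintro n ⟨R, hfin, rfl, hR⟩
  let ψ : (minGens Γ →₀ ℕ) → (S → ℚ) := fun x s => if x = s then 1 else 0
  have hψ : ∀ u v c, factorizationHom Γ u = factorizationHom Γ v → c ≠ 0 →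
      ψ (u + c) = ψ (v + c) := by
    intro u v c huv hc
    obtain ⟨g, d, rfl⟩ := exists_eq_single_add_of_ne_zero hc
    have key : ∀ u v, factorizationHom Γ u = factorizationHom Γ v → ∀ s ∈ S,
        u + (Finsupp.single g 1 + d) = s → v + (Finsupp.single g 1 + d) = s := by
      intro u v huv s hs h
      have hu := hdiv s hs g (u + d) (by rw [← h]; abel) (v + d) (by simp [huv])
      rw [add_right_cancel hu, h]
    funext s
    exact if_congr ⟨key u v huv s s.2, key v u huv.symm s s.2⟩ rfl rfl
  let D := hfin.toFinset.image fun p => ψ p.1 - ψ p.2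
  let W := Submodule.span ℚ (D : Set (S → ℚ))
  let C : AddCon (minGens Γ →₀ ℕ) :=
    { r := fun x y => factorizationHom Γ x = factorizationHom Γ y ∧ ψ x - ψ y ∈ W
      iseqv :=
        { refl := fun x => ⟨rfl, by simp⟩
          symm := fun {x y} h => ⟨h.1.symm, by simpa using W.neg_mem h.2⟩
          trans := fun {x y z} h h' =>
            ⟨h.1.trans h'.1, by simpa using W.add_mem h.2 h'.2⟩ }
      add' := by
        rintro w x y z ⟨h1, h2⟩ ⟨h3, h4⟩
        refine ⟨by rw [map_add, map_add, h1, h3], ?_⟩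
        by_cases hy : y = 0
        · subst hy
          obtain rfl := factorizationHom_eq_zero (x := z) (by rw [← h3, map_zero])
          simpa using h2
        by_cases hx : x = 0
        · subst hx
          obtain rfl := factorizationHom_eq_zero (x := w) (by rw [h1, map_zero])
          simpa using h4
        rw [hψ w x y h1 hy, add_comm x y, add_comm x z, hψ y z x h3 hx, sub_self]
        exact W.zero_mem }
  have hker : AddCon.ker (factorizationHom Γ) ≤ C := by
    rw [← hR, AddCon.addConGen_le]
    intro x y hxy
    refine ⟨?_, Submodule.subset_span (Finset.mem_coe.2 (Finset.mem_image.2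
      ⟨(x, y), hfin.mem_toFinset.2 hxy, rfl⟩))⟩
    have : AddCon.ker (factorizationHom Γ) x y := by
      rw [← hR]
      exact AddConGen.Rel.of _ _ hxy
    exact this
  have htop : W = ⊤ := by
    rw [eq_top_iff, ← (Pi.basisFun ℚ S).span_eq, Submodule.span_le]
    rintro _ ⟨s, rfl⟩
    have hs : ψ s - ψ (t s) ∈ W := (hker (x := (s : minGens Γ →₀ ℕ)) (y := t s)
      ((ht s s.2).1).symm).2
    suffices h : Pi.basisFun ℚ S s = ψ s - ψ (t s) by rwa [SetLike.mem_coe, h]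
    funext r
    have htr : t s ≠ r := by
      intro h
      exact (ht s s.2).2 (h ▸ ha r r.2)
    rw [Pi.basisFun_apply, Pi.single_apply, Pi.sub_apply]
    simp only [ψ, if_neg htr, sub_zero]
    exact if_congr (by rw [Subtype.ext_iff, eq_comm]) rfl rfl
  calc S.card = Module.finrank ℚ (S → ℚ) := by simp
    _ = Module.finrank ℚ W := by rw [htop, finrank_top]
    _ ≤ D.card := finrank_span_finset_le_card D
    _ ≤ hfin.toFinset.card := Finset.card_image_le
    _ = R.ncard := (Set.ncard_eq_toFinset_card R hfin).symm

/-- The value of an unordered pair, as a formal combination. -/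
noncomputable def pairFinsupp {α : Type*} (z : Sym2 α) : α →₀ ℕ :=
  Sym2.lift ⟨fun p q => Finsupp.single p 1 + Finsupp.single q 1, fun _ _ => add_comm _ _⟩ z

@[simp]
lemma pairFinsupp_mk {α : Type*} (p q : α) :
    pairFinsupp s(p, q) = Finsupp.single p 1 + Finsupp.single q 1 := rfl

lemma pairFinsupp_injective {α : Type*} : Function.Injective (pairFinsupp (α := α)) := by
  intro z w h
  induction z using Sym2.ind with | _ p q
  induction w using Sym2.ind with | _ r s
  rw [pairFinsupp_mk, pairFinsupp_mk] at h
  rcases eq_or_eq_of_add_single_eq h with h' | h'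
  · have hp := Finsupp.single_left_injective one_ne_zero h'
    subst hp
    rw [Finsupp.single_left_injective one_ne_zero (add_left_cancel h)]
  · have hp := Finsupp.single_left_injective one_ne_zero h'
    subst hp
    rw [add_comm (Finsupp.single r 1)] at h
    rw [Finsupp.single_left_injective one_ne_zero (add_left_cancel h), Sym2.eq_swap]

end General

section QuadricsAndCubics

variable {α : Type*}

/-- The four monomials of degree three in `b` and `c`. -/
noncomputable def cubics [DecidableEq α] (b c : α) : Finset (α →₀ ℕ) :=
  {Finsupp.single b 1 + (Finsupp.single b 1 + Finsupp.single b 1),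
    Finsupp.single b 1 + (Finsupp.single b 1 + Finsupp.single c 1),
    Finsupp.single b 1 + (Finsupp.single c 1 + Finsupp.single c 1),
    Finsupp.single c 1 + (Finsupp.single c 1 + Finsupp.single c 1)}

/-- The monomials of degree two avoiding `a` and not in `b` and `c` only, together with the
monomials of degree three in `b` and `c`. -/
noncomputable def quadricsAndCubics [DecidableEq α] [Fintype α] (a b c : α) :
    Finset (α →₀ ℕ) :=
  ((Finset.univ.erase a).sym2 \ ({b, c} : Finset α).sym2).image pairFinsupp ∪ cubics b c

lemma mem_cubics [DecidableEq α] {b c : α} {s : α →₀ ℕ} : s ∈ cubics b c ↔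
    ∃ p q r, (p = b ∨ p = c) ∧ (q = b ∨ q = c) ∧ (r = b ∨ r = c) ∧
      s = Finsupp.single p 1 + (Finsupp.single q 1 + Finsupp.single r 1) := by
  simp only [cubics, Finset.mem_insert, Finset.mem_singleton]
  constructor
  · rintro (rfl | rfl | rfl | rfl)
    · exact ⟨b, b, b, by simp⟩
    · exact ⟨b, b, c, by simp⟩
    · exact ⟨b, c, c, by simp⟩
    · exact ⟨c, c, c, by simp⟩
  · rintro ⟨p, q, r, hp, hq, hr, rfl⟩
    generalize hx : Finsupp.single b 1 = x
    generalize hy : Finsupp.single c 1 = y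
    have h1 : x + (y + x) = x + (x + y) := by abel
    have h2 : y + (x + x) = x + (x + y) := by abel
    have h3 : y + (x + y) = x + (y + y) := by abel
    have h4 : y + (y + x) = x + (y + y) := by abel
    rcases hp with rfl | rfl <;> rcases hq with rfl | rfl <;> rcases hr with rfl | rfl <;>
      simp only [hx, hy, h1, h2, h3, h4, true_or, or_true]

lemma card_cubics [DecidableEq α] {b c : α} (hbc : b ≠ c) : (cubics b c).card = 4 := by
  have himage : (cubics b c).image (fun x => x b) = {3, 2, 1, 0} := by
    simp [cubics, hbc.symm]
  refine le_antisymm Finset.card_le_four ?_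
  calc 4 = ((cubics b c).image fun x => x b).card := by rw [himage]; rfl
    _ ≤ (cubics b c).card := Finset.card_image_le

variable [DecidableEq α] [Fintype α] {a b c : α}

lemma mem_quadricsAndCubics {s : α →₀ ℕ} : s ∈ quadricsAndCubics a b c ↔
    (∃ p q, (p ≠ a ∧ q ≠ a) ∧ ¬ ((p = b ∨ p = c) ∧ (q = b ∨ q = c)) ∧
      s = Finsupp.single p 1 + Finsupp.single q 1) ∨
    ∃ p q r, (p = b ∨ p = c) ∧ (q = b ∨ q = c) ∧ (r = b ∨ r = c) ∧
      s = Finsupp.single p 1 + (Finsupp.single q 1 + Finsupp.single r 1) := by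
  rw [quadricsAndCubics, Finset.mem_union, mem_cubics, Finset.mem_image]
  refine or_congr_left ⟨?_, ?_⟩
  · rintro ⟨z, hz, rfl⟩
    induction z using Sym2.ind with | _ p q
    exact ⟨p, q, by simpa using hz⟩
  · rintro ⟨p, q, hpq, hn, rfl⟩
    exact ⟨s(p, q), by simpa using ⟨hpq, by simpa using hn⟩, rfl⟩

lemma card_quadricsAndCubics (hab : a ≠ b) (hac : a ≠ c) (hbc : b ≠ c) :
    (quadricsAndCubics a b c).card = (Fintype.card α).choose 2 + 1 := by
  have hdisj : Disjoint
      (((Finset.univ.erase a).sym2 \ ({b, c} : Finset α).sym2).image pairFinsupp)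
      (cubics b c) := by
    rw [Finset.disjoint_left]
    intro s hs hs'
    obtain ⟨z, hz, rfl⟩ := Finset.mem_image.1 hs
    obtain ⟨p, q, r, -, -, -, h⟩ := mem_cubics.1 hs'
    induction z using Sym2.ind with | _ x y
    have := congrArg Finsupp.degree h
    simp [map_add] at this
  have hsub : ({b, c} : Finset α).sym2 ⊆ (Finset.univ.erase a).sym2 := by
    apply Finset.sym2_mono
    intro g hg
    simp only [Finset.mem_insert, Finset.mem_singleton] at hg
    rcases hg with rfl | rfl
    · simpa using hab.symm
    · simpa using hac.symm
  have hpos : 0 < Fintype.card α := Fintype.card_pos_iff.2 ⟨a⟩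
  have hcard := Finset.card_sdiff_add_card_eq_card hsub
  rw [Finset.card_sym2, Finset.card_sym2, Finset.card_pair hbc,
    Finset.card_erase_of_mem (Finset.mem_univ _), Finset.card_univ,
    Nat.sub_add_cancel hpos, show Nat.choose (2 + 1) 2 = 3 from rfl] at hcard
  rw [quadricsAndCubics, Finset.card_union_of_disjoint hdisj,
    Finset.card_image_of_injective _ pairFinsupp_injective, card_cubics hbc]
  omega

end QuadricsAndCubics

section Example

/-- The generators of the example. -/
def exampleGens (e : ℕ) : Set ℕ :=
  {e + 4, e + 5, e + 7, 2 * e + 13} ∪ {x | 2 * e + 15 ≤ x ∧ x ≤ 3 * e + 11}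

lemma mem_exampleGens {e n : ℕ} : n ∈ exampleGens e ↔
    n = e + 4 ∨ n = e + 5 ∨ n = e + 7 ∨ n = 2 * e + 13 ∨ (2 * e + 15 ≤ n ∧ n ≤ 3 * e + 11) := by
  simp only [exampleGens, Set.mem_union, Set.mem_insert_iff, Set.mem_singleton_iff,
    Set.mem_ofPred_eq]
  tauto

variable {e : ℕ}

lemma mem_closure_exampleGens (he : 3 ≤ e) {n : ℕ} :
    n ∈ AddSubmonoid.closure (exampleGens e) ↔
      n = 0 ∨ n = e + 4 ∨ n = e + 5 ∨ n = e + 7 ∨ 2 * e + 8 ≤ n := by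
  constructor
  · intro h
    induction h using AddSubmonoid.closure_induction with
    | mem x hx => rw [mem_exampleGens] at hx; omega
    | zero => simp
    | add x y _ _ hx hy => omega
  · have hg : ∀ k, k = e + 4 ∨ k = e + 5 ∨ k = e + 7 ∨ k = 2 * e + 13 ∨
        (2 * e + 15 ≤ k ∧ k ≤ 3 * e + 11) → k ∈ AddSubmonoid.closure (exampleGens e) :=
      fun k hk => AddSubmonoid.subset_closure (mem_exampleGens.2 hk)
    induction n using Nat.strong_induction_on with
    | _ n ih =>
      intro h
      have hadd : ∀ k l, k ∈ AddSubmonoid.closure (exampleGens e) →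
          l ∈ AddSubmonoid.closure (exampleGens e) → n = k + l →
          n ∈ AddSubmonoid.closure (exampleGens e) := by
        rintro k l hk hl rfl
        exact add_mem hk hl
      by_cases h0 : n = 0
      · rw [h0]; exact zero_mem _
      by_cases h1 : n = e + 4 ∨ n = e + 5 ∨ n = e + 7 ∨ n = 2 * e + 13 ∨
        (2 * e + 15 ≤ n ∧ n ≤ 3 * e + 11)
      · exact hg n h1
      by_cases h2 : n = 2 * e + 10 ∨ n = 2 * e + 12
      · exact hadd (e + 5) (n - (e + 5)) (hg _ (by omega)) (hg _ (by omega)) (by omega)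
      by_cases h3 : n = 2 * e + 14
      · exact hadd (e + 7) (e + 7) (hg _ (by omega)) (hg _ (by omega)) (by omega)
      · exact hadd (e + 4) (n - (e + 4)) (hg _ (by omega)) (ih _ (by omega) (by omega))
          (by omega)

lemma minGens_closure_exampleGens (he : 3 ≤ e) :
    minGens (AddSubmonoid.closure (exampleGens e)) = exampleGens e := by
  ext n
  rw [mem_exampleGens]
  simp only [minGens, Set.mem_ofPred_eq, mem_closure_exampleGens he]
  constructor
  · rintro ⟨h, h0, hn⟩
    by_contra hc
    by_cases h2 : n = 2 * e + 10 ∨ n = 2 * e + 12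
    · exact hn (e + 5) (by omega) (n - (e + 5)) (by omega) (by omega) (by omega) (by omega)
    by_cases h3 : n = 2 * e + 14
    · exact hn (e + 7) (by omega) (e + 7) (by omega) (by omega) (by omega) (by omega)
    · exact hn (e + 4) (by omega) (n - (e + 4)) (by omega) (by omega) (by omega) (by omega)
  · intro h
    refine ⟨by omega, by omega, ?_⟩
    intro x hx y hy hx0 hy0
    omega

lemma ncard_exampleGens (he : 3 ≤ e) : (exampleGens e).ncard = e + 1 := by
  have : exampleGens e =
      (({e + 4, e + 5, e + 7, 2 * e + 13} ∪ Finset.Icc (2 * e + 15) (3 * e + 11) : Finset ℕ) :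
        Set ℕ) := by
    ext n
    simp [exampleGens, or_assoc]
  rw [this, Set.ncard_coe_finset, Finset.card_union_of_disjoint]
  · rw [Finset.card_insert_of_notMem, Finset.card_insert_of_notMem, Finset.card_insert_of_notMem,
      Finset.card_singleton, Nat.card_Icc]
    · omega
    all_goals simp
    all_goals omega
  · rw [Finset.disjoint_left]
    intro n hn hn'
    simp at hn hn'
    omega

lemma rho_closure_exampleGens (he : 3 ≤ e) :
    rho (AddSubmonoid.closure (exampleGens e)) = Nat.choose (e + 1) 2 + 1 := by
  classical
  set Γ := AddSubmonoid.closure (exampleGens e)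
  have hmin : minGens Γ = exampleGens e := minGens_closure_exampleGens he
  have hmem : ∀ {n}, n ∈ Γ ↔ n = 0 ∨ n = e + 4 ∨ n = e + 5 ∨ n = e + 7 ∨ 2 * e + 8 ≤ n :=
    mem_closure_exampleGens he
  have hcl : AddSubmonoid.closure (minGens Γ) = Γ := by rw [hmin]
  have hval : ∀ g : minGens Γ, (g : ℕ) = e + 4 ∨ (g : ℕ) = e + 5 ∨ (g : ℕ) = e + 7 ∨
      (g : ℕ) = 2 * e + 13 ∨ (2 * e + 15 ≤ (g : ℕ) ∧ (g : ℕ) ≤ 3 * e + 11) := fun g => by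
    rw [← mem_exampleGens, ← hmin]
    exact g.2
  obtain ⟨a, ha⟩ : ∃ a : minGens Γ, (a : ℕ) = e + 4 :=
    ⟨⟨e + 4, by rw [hmin, mem_exampleGens]; omega⟩, rfl⟩
  obtain ⟨b, hb⟩ : ∃ b : minGens Γ, (b : ℕ) = e + 5 :=
    ⟨⟨e + 5, by rw [hmin, mem_exampleGens]; omega⟩, rfl⟩
  obtain ⟨c, hc⟩ : ∃ c : minGens Γ, (c : ℕ) = e + 7 :=
    ⟨⟨e + 7, by rw [hmin, mem_exampleGens]; omega⟩, rfl⟩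
  have hab : a ≠ b := fun h => by rw [h] at ha; omega
  have hac : a ≠ c := fun h => by rw [h] at ha; omega
  have hbc : b ≠ c := fun h => by rw [h] at hb; omega
  have hcase : ∀ g : minGens Γ, g ≠ a → (g : ℕ) < 2 * e + 13 → g = b ∨ g = c := by
    intro g hga hg
    rw [Ne, Subtype.ext_iff] at hga
    rw [Subtype.ext_iff, Subtype.ext_iff]
    have := hval g
    omega
  have hfin : (minGens Γ).Finite :=
    Set.finite_of_ncard_ne_zero (by rw [hmin, ncard_exampleGens he]; omega)
  have : Fintype (minGens Γ) := hfin.fintype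
  have hcardG : Fintype.card (minGens Γ) = e + 1 := by
    rw [← Nat.card_eq_fintype_card, Nat.card_coe_set_eq, hmin, ncard_exampleGens he]
  let δ : minGens Γ → (minGens Γ →₀ ℕ) := fun g => Finsupp.single g 1
  have hu2 : ∀ p q : minGens Γ, (p = b ∨ p = c) → (q = b ∨ q = c) →
      IsUniqueFactorization Γ (δ p + δ q) := by
    intro p q hp hq
    apply isUniqueFactorization_single_add_single
    intro g n hn h
    rw [hmem] at hn
    have hg := hval g
    rw [Subtype.ext_iff, Subtype.ext_iff]
    rcases hp with rfl | rfl <;> rcases hq with rfl | rfl <;> omega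
  have hS' : ∀ s ∈ quadricsAndCubics a b c,
      (∃ p q, (p ≠ a ∧ q ≠ a) ∧ ¬ ((p = b ∨ p = c) ∧ (q = b ∨ q = c)) ∧ s = δ p + δ q) ∨
      ∃ p q r : minGens Γ, (p = b ∨ p = c) ∧ (q = b ∨ q = c) ∧
      (r = b ∨ r = c) ∧ s = δ p + (δ q + δ r) :=
    fun s hs => mem_quadricsAndCubics.1 hs
  have hne : ∀ g : minGens Γ, (g = b ∨ g = c) → g ≠ a := by
    rintro g (rfl | rfl)
    · exact hab.symm
    · exact hac.symm
  have hδa : ∀ g, g ≠ a → δ g a = 0 := fun g hg => by simp [δ, hg]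
  rw [← hcardG, ← card_quadricsAndCubics hab hac hbc]
  apply rho_eq_card _ a
  · intro x hx
    by_cases hu : IsUniqueFactorization Γ x
    · exact Or.inl hu
    right
    have hpeel : ∀ y : minGens Γ →₀ ℕ, y a = 0 → y ≠ 0 →
        ∃ g z, y = δ g + z ∧ g ≠ a ∧ z a = 0 := by
      intro y hy hy0
      obtain ⟨g, z, rfl⟩ := exists_eq_single_add_of_ne_zero hy0
      simp only [Finsupp.add_apply, Nat.add_eq_zero_iff] at hy
      refine ⟨g, z, rfl, ?_, hy.2⟩
      rintro rfl
      simp at hy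
    obtain ⟨p, y, rfl, hp, hy⟩ := hpeel x hx (by rintro rfl; exact hu isUniqueFactorization_zero)
    obtain ⟨q, z, rfl, hq, hz⟩ := hpeel y hy
      (by rintro rfl; exact hu (by simpa using isUniqueFactorization_single p))
    by_cases hpq : (p = b ∨ p = c) ∧ (q = b ∨ q = c)
    · obtain ⟨r, w, rfl, hr, hw⟩ := hpeel z hz
        (by rintro rfl; exact hu (by simpa using hu2 p q hpq.1 hpq.2))
      by_cases hr' : r = b ∨ r = c
      · exact ⟨δ p + (δ q + δ r), mem_quadricsAndCubics.2
          (Or.inr ⟨p, q, r, hpq.1, hpq.2, hr', rfl⟩), w, by abel⟩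
      · exact ⟨δ p + δ r, mem_quadricsAndCubics.2
          (Or.inl ⟨p, r, ⟨hp, hr⟩, fun h => hr' h.2, rfl⟩), δ q + w, by abel⟩
    · exact ⟨δ p + δ q, mem_quadricsAndCubics.2
        (Or.inl ⟨p, q, ⟨hp, hq⟩, hpq, rfl⟩), z, by abel⟩
  · intro s hs g x hx
    rcases hS' s hs with ⟨p, q, -, -, rfl⟩ | ⟨p, q, r, hp, hq, hr, rfl⟩
    · rcases eq_or_eq_of_add_single_eq hx with rfl | rfl <;>
        exact isUniqueFactorization_single _
    · have hg : g = p ∨ g = q ∨ g = r := by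
        by_contra! hg
        have := DFunLike.congr_fun hx g
        simp [δ, hg.1.symm, hg.2.1.symm, hg.2.2.symm] at this
      rcases hg with rfl | rfl | rfl
      · have : x = δ q + δ r := add_right_cancel (hx.trans (add_comm _ _))
        exact this ▸ hu2 q r hq hr
      · have : x = δ p + δ r := add_right_cancel (b := δ g) (hx.trans (by abel))
        exact this ▸ hu2 p r hp hr
      · have : x = δ p + δ q := add_right_cancel (b := δ g) (hx.trans (by abel))
        exact this ▸ hu2 p q hp hq
  · intro s hs
    rcases hS' s hs with ⟨p, q, hpq, -, rfl⟩ | ⟨p, q, r, hp, hq, hr, rfl⟩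
    · simp [hδa p hpq.1, hδa q hpq.2]
    · simp [hδa p (hne p hp), hδa q (hne q hq), hδa r (hne r hr)]
  · intro s hs
    have hlarge : 3 * e + 12 ≤ factorizationHom Γ s := by
      rcases hS' s hs with ⟨p, q, hpq, hn, rfl⟩ | ⟨p, q, r, -, -, -, rfl⟩
      · simp only [δ, map_add, factorizationHom_single, mul_one]
        have := hval p
        have := hval q
        have : 2 * e + 13 ≤ (p : ℕ) ∨ 2 * e + 13 ≤ (q : ℕ) := by
          by_contra! hlt
          exact hn ⟨hcase p hpq.1 hlt.1, hcase q hpq.2 hlt.2⟩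
        omega
      · simp only [δ, map_add, factorizationHom_single, mul_one]
        have := hval p
        have := hval q
        have := hval r
        omega
    obtain ⟨y, hy⟩ := exists_factorization hcl
      (n := factorizationHom Γ s - (e + 4)) (hmem.2 (by omega))
    refine ⟨δ a + y, ?_, by simp [δ]⟩
    simp only [δ, map_add, factorizationHom_single, mul_one, hy, ha]
    omega

end Example

/-- The monoid ⟨e+4, e+5, e+7, 2e+13, 2e+15, …, 3e+11⟩ is a numerical monoid with
multiplicity e+4, minimal generators as listed, embedding dimension e+1, and
ρ = C(e+1,2) + 1. -/
theorem rho_example_delta4 (e : ℕ) (he : 3 ≤ e) :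
    IsNumericalMonoid (AddSubmonoid.closure
        ({e + 4, e + 5, e + 7, 2 * e + 13} ∪ {x | 2 * e + 15 ≤ x ∧ x ≤ 3 * e + 11})) ∧
    mult (AddSubmonoid.closure
        ({e + 4, e + 5, e + 7, 2 * e + 13} ∪ {x | 2 * e + 15 ≤ x ∧ x ≤ 3 * e + 11})) = e + 4 ∧
    minGens (AddSubmonoid.closure
        ({e + 4, e + 5, e + 7, 2 * e + 13} ∪ {x | 2 * e + 15 ≤ x ∧ x ≤ 3 * e + 11})) =
      ({e + 4, e + 5, e + 7, 2 * e + 13} ∪ {x | 2 * e + 15 ≤ x ∧ x ≤ 3 * e + 11}) ∧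
    edim (AddSubmonoid.closure
        ({e + 4, e + 5, e + 7, 2 * e + 13} ∪ {x | 2 * e + 15 ≤ x ∧ x ≤ 3 * e + 11})) = e + 1 ∧
    rho (AddSubmonoid.closure
        ({e + 4, e + 5, e + 7, 2 * e + 13} ∪ {x | 2 * e + 15 ≤ x ∧ x ≤ 3 * e + 11})) =
      Nat.choose (e + 1) 2 + 1 := by
  change IsNumericalMonoid (AddSubmonoid.closure (exampleGens e)) ∧
    mult (AddSubmonoid.closure (exampleGens e)) = e + 4 ∧
    minGens (AddSubmonoid.closure (exampleGens e)) = exampleGens e ∧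
    edim (AddSubmonoid.closure (exampleGens e)) = e + 1 ∧
    rho (AddSubmonoid.closure (exampleGens e)) = Nat.choose (e + 1) 2 + 1
  refine ⟨?_, ?_, minGens_closure_exampleGens he, ?_, rho_closure_exampleGens he⟩
  · refine (Set.finite_lt_nat (2 * e + 8)).subset fun n hn => ?_
    by_contra h
    exact hn ((mem_closure_exampleGens he).2 (by simp at h; omega))
  · refine (IsLeast.csInf_eq ⟨⟨(mem_closure_exampleGens he).2 (by omega), by omega⟩, ?_⟩)
    rintro n ⟨hn, hn0⟩
    rw [mem_closure_exampleGens he] at hn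
    omega
  · rw [edim, minGens_closure_exampleGens he, ncard_exampleGens he]
end
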